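/- The set of bounded observables of a complete lattice effect algebra E is a Dedekind complete lattice under the Olson order: every family bounded from below has an infimum and every family bounded from above has a supremum. Moreover, the set of observables with spectrum contained in [0,1] is a complete lattice with bottom element q_0 and top element q_1. -/

import Mathlib

structure EffectAlgebra (E : Type*) where
  add : E → E → Option E
  zero : E
  one : E
  comm : ∀ a b, add a b = add b a
  assoc : ∀ a b c, (add a b).bind (fun d => add d c) = (add b c).bind (fun d => add a d)
  orth : ∀ a : E, ∃! b, add a b = some one
  pos_one : ∀ a b, add a one = some b → a = zero

namespace EffectAlgebra

variable {E : Type*}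

/-- The induced order: `a ≤ b` iff `a + c = b` for some `c`. -/
def le (EA : EffectAlgebra E) (a b : E) : Prop := ∃ c, EA.add a c = some b

/-- The orthosupplement `a'`, the unique element with `a + a' = 1`. -/
noncomputable def orthosupp (EA : EffectAlgebra E) (a : E) : E :=
  Classical.choose (EA.orth a).exists

/-- `s` is the supremum of `S` with respect to the induced order. -/
def IsSup (EA : EffectAlgebra E) (S : Set E) (s : E) : Prop :=
  (∀ x ∈ S, EA.le x s) ∧ ∀ b, (∀ x ∈ S, EA.le x b) → EA.le s b

/-- `s` is the infimum of `S` with respect to the induced order. -/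
def IsInf (EA : EffectAlgebra E) (S : Set E) (s : E) : Prop :=
  (∀ x ∈ S, EA.le s x) ∧ ∀ b, (∀ x ∈ S, EA.le b x) → EA.le b s

/-- Every increasing sequence has a supremum. -/
def MonotoneSigmaComplete (EA : EffectAlgebra E) : Prop :=
  ∀ f : ℕ → E, (∀ n, EA.le (f n) (f (n + 1))) → ∃ s, EA.IsSup (Set.range f) s

/-- A σ-lattice effect algebra: countable suprema and infima exist. -/
def SigmaLattice (EA : EffectAlgebra E) : Prop :=
  (∀ f : ℕ → E, ∃ s, EA.IsSup (Set.range f) s) ∧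
  (∀ f : ℕ → E, ∃ s, EA.IsInf (Set.range f) s)

/-- A complete lattice effect algebra: arbitrary suprema and infima exist. -/
def CompleteEA (EA : EffectAlgebra E) : Prop :=
  (∀ S : Set E, ∃ s, EA.IsSup S s) ∧ (∀ S : Set E, ∃ s, EA.IsInf S s)

/-- A lattice effect algebra: binary suprema and infima exist. -/
def LatticeEA (EA : EffectAlgebra E) : Prop :=
  (∀ a b : E, ∃ s, EA.IsSup {a, b} s) ∧ (∀ a b : E, ∃ s, EA.IsInf {a, b} s)

end EffectAlgebra

/-- Borel subsets of the real line. -/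
abbrev BorelSet := {A : Set ℝ // MeasurableSet A}

def bIio (t : ℝ) : BorelSet := ⟨Set.Iio t, measurableSet_Iio⟩
def bIic (t : ℝ) : BorelSet := ⟨Set.Iic t, measurableSet_Iic⟩

/-- An observable on a (monotone σ-complete) effect algebra: a unital,
additive map on the Borel σ-algebra preserving suprema of increasing sequences. -/
structure Observable {E : Type*} (EA : EffectAlgebra E) where
  toFun : BorelSet → E
  unital : toFun ⟨Set.univ, MeasurableSet.univ⟩ = EA.one
  additive : ∀ A B : BorelSet, Disjoint A.1 B.1 →
    EA.add (toFun A) (toFun B) = some (toFun ⟨A.1 ∪ B.1, A.2.union B.2⟩)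
  sup_cont : ∀ f : ℕ → BorelSet, (∀ n, (f n).1 ⊆ (f (n + 1)).1) →
    EA.IsSup (Set.range fun n => toFun (f n))
      (toFun ⟨⋃ n, (f n).1, MeasurableSet.iUnion (fun n => (f n).2)⟩)

namespace Observable

variable {E : Type*} {EA : EffectAlgebra E}

/-- The Olson (spectral) order on observables. -/
def OlsonLe (x y : Observable EA) : Prop :=
  ∀ t : ℝ, EA.le (y.toFun (bIio t)) (x.toFun (bIio t))

/-- An observable is bounded if `x(C) = 1` for some compact set `C`. -/
def Bounded (x : Observable EA) : Prop :=
  ∃ C : Set ℝ, ∃ hC : IsCompact C, x.toFun ⟨C, hC.measurableSet⟩ = EA.one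

/-- `x` is the question observable `q_a` of the element `a`. -/
def IsQuestion (x : Observable EA) (a : E) : Prop :=
  ∀ t : ℝ, x.toFun (bIio t) =
    if t ≤ 0 then EA.zero else if t ≤ 1 then EA.orthosupp a else EA.one

/-- The spectrum of `x` lies in `[0,1]`. -/
def SpectrumIn01 (x : Observable EA) : Prop :=
  x.toFun ⟨Set.Icc 0 1, measurableSet_Icc⟩ = EA.one

/-- `z` is the infimum of `S` in the Olson order on bounded observables. -/
def IsOlsonInf (S : Set (Observable EA)) (z : Observable EA) : Prop :=
  z.Bounded ∧ (∀ x ∈ S, z.OlsonLe x) ∧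
    ∀ w : Observable EA, w.Bounded → (∀ x ∈ S, w.OlsonLe x) → w.OlsonLe z

/-- `z` is the supremum of `S` in the Olson order on bounded observables. -/
def IsOlsonSup (S : Set (Observable EA)) (z : Observable EA) : Prop :=
  z.Bounded ∧ (∀ x ∈ S, x.OlsonLe z) ∧
    ∀ w : Observable EA, w.Bounded → (∀ x ∈ S, x.OlsonLe w) → z.OlsonLe w

end Observable

/-- A spectral resolution: monotone, with infimum 0, supremum 1, left continuous. -/
def SpectralResolution {E : Type*} (EA : EffectAlgebra E) (F : ℝ → E) : Prop :=
  (∀ t s : ℝ, t < s → EA.le (F t) (F s)) ∧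
  EA.IsInf (Set.range F) EA.zero ∧
  EA.IsSup (Set.range F) EA.one ∧
  ∀ s : ℝ, EA.IsSup (F '' Set.Iio s) (F s)

namespace EffectAlgebra

section Basic

variable {E : Type*} (EA : EffectAlgebra E) {a b c d e x y z w : E}

lemma add_symm (h : EA.add a b = some c) : EA.add b a = some c := EA.comm a b ▸ h

lemma assoc_right (h : EA.add a b = some d) (h' : EA.add d c = some e) :
    ∃ f, EA.add b c = some f ∧ EA.add a f = some e := by
  have := EA.assoc a b c
  rw [h, Option.bind_some, h'] at this
  exact Option.bind_eq_some_iff.1 this.symm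

lemma assoc_left (h : EA.add b c = some d) (h' : EA.add a d = some e) :
    ∃ f, EA.add a b = some f ∧ EA.add f c = some e := by
  have := EA.assoc a b c
  rw [h, Option.bind_some, h'] at this
  exact Option.bind_eq_some_iff.1 this

lemma add_orthosupp (a : E) : EA.add a (EA.orthosupp a) = some EA.one :=
  Classical.choose_spec (EA.orth a).exists

lemma eq_orthosupp (h : EA.add a b = some EA.one) : b = EA.orthosupp a :=
  (EA.orth a).unique h (EA.add_orthosupp a)

lemma orthosupp_orthosupp (a : E) : EA.orthosupp (EA.orthosupp a) = a :=
  (EA.eq_orthosupp (EA.add_symm (EA.add_orthosupp a))).symm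

lemma one_add_zero : EA.add EA.one EA.zero = some EA.one := by
  have h := EA.add_orthosupp EA.one
  rwa [EA.pos_one _ _ (EA.add_symm h)] at h

lemma add_zero (a : E) : EA.add a EA.zero = some a := by
  obtain ⟨f, hf, hf'⟩ := EA.assoc_right (EA.add_orthosupp (EA.orthosupp a)) EA.one_add_zero
  rw [EA.orthosupp_orthosupp] at hf
  rw [hf, EA.eq_orthosupp hf', EA.orthosupp_orthosupp]

lemma zero_add (a : E) : EA.add EA.zero a = some a := EA.add_symm (EA.add_zero a)

lemma orthosupp_one : EA.orthosupp EA.one = EA.zero := (EA.eq_orthosupp EA.one_add_zero).symm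

lemma orthosupp_zero : EA.orthosupp EA.zero = EA.one :=
  (EA.eq_orthosupp (EA.add_symm EA.one_add_zero)).symm

lemma add_left_cancel (h : EA.add a b = some d) (h' : EA.add a c = some d) : b = c := by
  obtain ⟨f, hf, hb⟩ := EA.assoc_right (EA.add_symm h) (EA.add_orthosupp d)
  obtain ⟨g, hg, hc⟩ := EA.assoc_right (EA.add_symm h') (EA.add_orthosupp d)
  obtain rfl : f = g := Option.some_injective _ (hf.symm.trans hg)
  rw [EA.eq_orthosupp (EA.add_symm hb), EA.eq_orthosupp (EA.add_symm hc)]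

lemma eq_zero_of_add (h : EA.add a b = some EA.zero) : a = EA.zero := by
  obtain ⟨f, hf, -⟩ := EA.assoc_right (EA.add_symm h) (EA.zero_add EA.one)
  exact EA.pos_one _ _ hf

lemma le_refl' (a : E) : EA.le a a := ⟨_, EA.add_zero a⟩

lemma le_trans' (h : EA.le a b) (h' : EA.le b c) : EA.le a c := by
  obtain ⟨u, hu⟩ := h
  obtain ⟨v, hv⟩ := h'
  obtain ⟨f, -, hf⟩ := EA.assoc_right hu hv
  exact ⟨f, hf⟩

lemma le_antisymm' (h : EA.le a b) (h' : EA.le b a) : a = b := by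
  obtain ⟨u, hu⟩ := h
  obtain ⟨v, hv⟩ := h'
  obtain ⟨f, hf, hf'⟩ := EA.assoc_right hu hv
  obtain rfl := EA.add_left_cancel hf' (EA.add_zero a)
  obtain rfl := EA.eq_zero_of_add hf
  exact Option.some_injective _ ((EA.add_zero a).symm.trans hu)

lemma le_one (a : E) : EA.le a EA.one := ⟨_, EA.add_orthosupp a⟩

lemma zero_le (a : E) : EA.le EA.zero a := ⟨_, EA.zero_add a⟩

lemma le_of_add (h : EA.add a b = some c) : EA.le a c := ⟨_, h⟩

lemma le_of_add' (h : EA.add a b = some c) : EA.le b c := ⟨_, EA.add_symm h⟩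

/-- If `b ≤ c` and `a + c` is defined, so is `a + b`, and `a + b ≤ a + c`. -/
lemma add_le_add (h : EA.add a c = some d) (hb : EA.le b c) :
    ∃ e, EA.add a b = some e ∧ EA.le e d := by
  obtain ⟨u, hu⟩ := hb
  obtain ⟨f, hf, hf'⟩ := EA.assoc_left hu h
  exact ⟨f, hf, _, hf'⟩

lemma le_of_add_le_add (h : EA.add a b = some d) (h' : EA.add a c = some e) (hde : EA.le d e) :
    EA.le b c := by
  obtain ⟨u, hu⟩ := hde
  obtain ⟨f, hf, hf'⟩ := EA.assoc_right h hu
  rw [← EA.add_left_cancel hf' h']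
  exact ⟨u, hf⟩

lemma exists_add_iff : (∃ c, EA.add a b = some c) ↔ EA.le a (EA.orthosupp b) := by
  constructor
  · rintro ⟨c, h⟩
    obtain ⟨f, hf, hf'⟩ := EA.assoc_right (EA.add_symm h) (EA.add_orthosupp c)
    exact ⟨_, EA.eq_orthosupp hf' ▸ hf⟩
  · intro h
    obtain ⟨e, he, -⟩ := EA.add_le_add (EA.add_orthosupp b) h
    exact ⟨e, EA.add_symm he⟩

lemma orthosupp_le_orthosupp (h : EA.le a b) : EA.le (EA.orthosupp b) (EA.orthosupp a) := by
  obtain ⟨u, hu⟩ := h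
  obtain ⟨f, hf, hf'⟩ := EA.assoc_right hu (EA.add_orthosupp b)
  exact ⟨u, EA.add_symm (EA.eq_orthosupp hf' ▸ hf)⟩

lemma add_add_add_comm {ab cd s ac : E} (hab : EA.add a b = some ab) (hcd : EA.add c d = some cd)
    (hs : EA.add ab cd = some s) (hac : EA.add a c = some ac) :
    ∃ bd, EA.add b d = some bd ∧ EA.add ac bd = some s := by
  obtain ⟨f, hf, hf'⟩ := EA.assoc_right hab hs
  obtain ⟨g, hg, hg'⟩ := EA.assoc_left (EA.add_symm hcd) hf
  obtain ⟨k, hk, hk'⟩ := EA.assoc_left (EA.add_symm hg') hf'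
  obtain rfl : ac = k := Option.some_injective _ (hac.symm.trans hk)
  exact ⟨g, hg, hk'⟩

/-- `x + y + z = 1`. -/
def Tri (x y z : E) : Prop := ∃ w, EA.add x y = some w ∧ EA.add w z = some EA.one

lemma Tri.swap {EA : EffectAlgebra E} (h : EA.Tri x y z) : EA.Tri y x z := by
  obtain ⟨w, h1, h2⟩ := h
  exact ⟨w, EA.add_symm h1, h2⟩

lemma Tri.rotate {EA : EffectAlgebra E} (h : EA.Tri x y z) : EA.Tri y z x := by
  obtain ⟨w, h1, h2⟩ := h
  obtain ⟨f, hf, hf'⟩ := EA.assoc_right h1 h2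
  exact ⟨f, hf, EA.add_symm hf'⟩

lemma Tri.add_eq {EA : EffectAlgebra E} (h : EA.Tri x y z) :
    EA.add x y = some (EA.orthosupp z) := by
  obtain ⟨w, h1, h2⟩ := h
  rwa [← EA.eq_orthosupp (EA.add_symm h2)]

lemma tri_of_add (h : EA.add x y = some z) : EA.Tri x y (EA.orthosupp z) :=
  ⟨z, h, EA.add_orthosupp z⟩

end Basic

section Linear

variable {E : Type*} (EA : EffectAlgebra E)

/-- `1/2 ≤ c`. -/
def Half (c : E) : Prop := EA.le (EA.orthosupp c) c

open Classical in
/-- Doubling modulo one. -/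
noncomputable def dbl (c : E) : E :=
  if h : EA.Half c then Classical.choose h else (EA.add c c).getD c

open Classical in
/-- The first binary digit of `c`. -/
noncomputable def digit (c : E) : ℝ := if EA.Half c then 1 else 0

/-- The real number whose binary digits are those of `c`. -/
noncomputable def binVal (c : E) : ℝ :=
  ∑' n : ℕ, EA.digit (EA.dbl^[n] c) * (1 / 2 : ℝ) ^ (n + 1)

variable {EA} {a b c x y z : E}

lemma dbl_of_half (h : EA.Half c) : EA.add (EA.orthosupp c) (EA.dbl c) = some c := by
  rw [dbl, dif_pos h]
  exact Classical.choose_spec h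

lemma summable_half_pow : Summable fun n : ℕ => (1 / 2 : ℝ) ^ (n + 1) :=
  (summable_nat_add_iff 1).2 summable_geometric_two

lemma digit_nonneg (c : E) : 0 ≤ EA.digit c := by
  unfold digit
  split_ifs <;> norm_num

lemma digit_le_one (c : E) : EA.digit c ≤ 1 := by
  unfold digit
  split_ifs <;> norm_num

lemma summable_binVal (c : E) :
    Summable fun n : ℕ => EA.digit (EA.dbl^[n] c) * (1 / 2 : ℝ) ^ (n + 1) :=
  summable_half_pow.of_nonneg_of_le (fun n => mul_nonneg (digit_nonneg _) (by positivity))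
    fun n => mul_le_of_le_one_left (by positivity) (digit_le_one _)

lemma binVal_nonneg (c : E) : 0 ≤ EA.binVal c :=
  tsum_nonneg fun n => mul_nonneg (digit_nonneg _) (by positivity)

lemma binVal_le_one (c : E) : EA.binVal c ≤ 1 := by
  have h : ∑' n : ℕ, (1 / 2 : ℝ) ^ (n + 1) = 1 := by
    simp_rw [pow_succ, tsum_mul_right, tsum_geometric_two]
    norm_num
  rw [← h]
  exact (summable_binVal c).tsum_le_tsum
    (fun n => mul_le_of_le_one_left (by positivity) (digit_le_one _)) summable_half_pow

lemma binVal_eq (c : E) : EA.binVal c = (EA.digit c + EA.binVal (EA.dbl c)) / 2 := by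
  rw [binVal, (summable_binVal c).tsum_eq_zero_add, binVal]
  simp_rw [Function.iterate_succ_apply, pow_succ _ (_ + 1), ← mul_assoc, tsum_mul_right]
  simp only [Function.iterate_zero, id_eq, _root_.zero_add, pow_one]
  ring

lemma binVal_of_half (h : EA.Half c) : EA.binVal c = (1 + EA.binVal (EA.dbl c)) / 2 := by
  rw [binVal_eq, digit, if_pos h]

lemma binVal_of_not_half (h : ¬ EA.Half c) : EA.binVal c = EA.binVal (EA.dbl c) / 2 := by
  rw [binVal_eq, digit, if_neg h, _root_.zero_add]

variable (EA) in
/-- The order of the effect algebra is total. -/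
def Total : Prop := ∀ a b, EA.le a b ∨ EA.le b a

lemma le_of_not_half (htot : EA.Total) (h : ¬ EA.Half c) : EA.le c (EA.orthosupp c) :=
  (htot _ _).resolve_right h

lemma dbl_of_not_half (htot : EA.Total) (h : ¬ EA.Half c) : EA.add c c = some (EA.dbl c) := by
  obtain ⟨d, hd⟩ := EA.exists_add_iff.2 (le_of_not_half htot h)
  rw [dbl, dif_neg h, hd, Option.getD_some]

lemma binVal_zero (h01 : EA.zero ≠ EA.one) : EA.binVal EA.zero = 0 := by
  have h : ¬ EA.Half EA.zero := fun h => h01 <| by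
    rw [Half, orthosupp_zero] at h
    exact EA.le_antisymm' (EA.zero_le _) h
  have h2 : EA.dbl EA.zero = EA.zero := by rw [dbl, dif_neg h, EA.add_zero, Option.getD_some]
  have := binVal_of_not_half h
  rw [h2] at this
  linarith

lemma binVal_one : EA.binVal EA.one = 1 := by
  have h : EA.Half EA.one := EA.le_one _
  have h2 := dbl_of_half h
  rw [orthosupp_one, EA.zero_add] at h2
  have := binVal_of_half h
  rw [Option.some_injective _ h2] at this
  linarith

lemma abs_binVal_orthosupp (htot : EA.Total) (h01 : EA.zero ≠ EA.one) (n : ℕ) (c : E) :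
    |EA.binVal c + EA.binVal (EA.orthosupp c) - 1| ≤ (1 / 2) ^ n := by
  induction n generalizing c with
  | zero =>
    have := binVal_nonneg (EA := EA) c
    have := binVal_nonneg (EA := EA) (EA.orthosupp c)
    have := binVal_le_one (EA := EA) c
    have := binVal_le_one (EA := EA) (EA.orthosupp c)
    rw [abs_le]
    constructor <;> simp <;> linarith
  | succ n ih =>
    have key : ∀ c, EA.Half c →
        |EA.binVal c + EA.binVal (EA.orthosupp c) - 1| ≤ (1 / 2) ^ (n + 1) := by
      intro c h
      have h1 := dbl_of_half h
      by_cases h' : EA.Half (EA.orthosupp c)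
      · rw [Half, orthosupp_orthosupp] at h'
        have hc := EA.le_antisymm' h' h
        rw [← hc] at h1 ⊢
        have h0 := EA.add_left_cancel h1 (EA.add_zero c)
        have := binVal_of_half h
        rw [h0, binVal_zero h01] at this
        rw [this]
        norm_num
      · have h2 := dbl_of_not_half htot h'
        obtain ⟨f, hf, hf'⟩ := EA.assoc_right (EA.add_symm h1)
          (EA.add_orthosupp c)
        rw [h2, Option.some_inj] at hf
        rw [← hf] at hf'
        have := ih (EA.dbl c)
        rw [binVal_of_half h, binVal_of_not_half h', EA.eq_orthosupp hf',
          show ∀ s t : ℝ, (1 + s) / 2 + t / 2 - 1 = (s + t - 1) * (1 / 2) by intros; ring,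
          abs_mul, pow_succ, abs_of_pos (show (0 : ℝ) < 1 / 2 by norm_num)]
        gcongr
    rcases htot (EA.orthosupp c) c with h | h
    · exact key c h
    · have := key (EA.orthosupp c) (by rwa [Half, orthosupp_orthosupp])
      rwa [orthosupp_orthosupp, _root_.add_comm] at this

lemma eq_zero_of_abs_le {r : ℝ} (h : ∀ n : ℕ, |r| ≤ 2 * (1 / 2) ^ n) : r = 0 := by
  have := (tendsto_pow_atTop_nhds_zero_of_lt_one (r := (1 / 2 : ℝ)) (by norm_num)
    (by norm_num)).const_mul 2
  rw [mul_zero] at this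
  exact abs_eq_zero.1 (le_antisymm (ge_of_tendsto' this h) (abs_nonneg r))

lemma binVal_orthosupp (htot : EA.Total) (h01 : EA.zero ≠ EA.one) (c : E) :
    EA.binVal (EA.orthosupp c) = 1 - EA.binVal c := by
  have := eq_zero_of_abs_le (r := EA.binVal c + EA.binVal (EA.orthosupp c) - 1) fun n =>
    (abs_binVal_orthosupp htot h01 n c).trans
      (le_mul_of_one_le_left (by positivity) (by norm_num))
  linarith

/-- The doubled triple when one entry is at least one half. -/
lemma Tri.dbl_of_half (htot : EA.Total) (h : EA.Tri x y z) (hz : EA.Half z) (hx : ¬ EA.Half x) (hy : ¬ EA.Half y) :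
    EA.Tri (EA.dbl x) (EA.dbl y) (EA.dbl z) := by
  have hw := h.add_eq
  have hd := EffectAlgebra.dbl_of_half hz
  have h1 := EA.add_symm (EA.add_orthosupp z)
  obtain ⟨s, hs, hs'⟩ := EA.assoc_left hd h1
  obtain ⟨t, ht, ht'⟩ := EA.add_add_add_comm hw hw hs (dbl_of_not_half htot hx)
  rw [dbl_of_not_half htot hy, Option.some_inj] at ht
  exact ⟨s, ht ▸ ht', hs'⟩

/-- The complements of the doubles when all entries are less than one half. -/
lemma Tri.orthosupp_dbl (htot : EA.Total) (h : EA.Tri x y z) (hx : ¬ EA.Half x) (hy : ¬ EA.Half y)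
    (hz : ¬ EA.Half z) (hxz : EA.le x z) :
    EA.Tri (EA.orthosupp (EA.dbl x)) (EA.orthosupp (EA.dbl z)) (EA.orthosupp (EA.dbl y)) := by
  obtain ⟨δ, hδ⟩ := hxz
  have hxx := dbl_of_not_half htot hx
  have hyy := dbl_of_not_half htot hy
  have hzz := dbl_of_not_half htot hz
  obtain ⟨p, hp, hp'⟩ := EA.add_add_add_comm hδ h.add_eq (EA.add_orthosupp z) hxx
  rw [EA.eq_orthosupp hp'] at hp
  obtain ⟨u, hu, hu'⟩ := EA.assoc_right hzz (EA.add_orthosupp (EA.dbl z))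
  rw [EA.eq_orthosupp hu'] at hu
  obtain ⟨v, hv, hv'⟩ := EA.assoc_right hδ hu
  obtain rfl := EA.add_left_cancel hv' h.add_eq
  obtain ⟨f, hf, hf'⟩ := EA.assoc_left hv hyy
  obtain rfl : f = _ := Option.some_injective _ (hf.symm.trans (EA.add_symm hp))
  exact EA.tri_of_add hf'

lemma abs_binVal_tri (htot : EA.Total) (h01 : EA.zero ≠ EA.one) (n : ℕ) :
    ∀ x y z, EA.Tri x y z →
      |EA.binVal x + EA.binVal y + EA.binVal z - 1| ≤ 2 * (1 / 2) ^ n := by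
  induction n with
  | zero =>
    intro x y z _
    have := binVal_nonneg (EA := EA) x
    have := binVal_nonneg (EA := EA) y
    have := binVal_nonneg (EA := EA) z
    have := binVal_le_one (EA := EA) x
    have := binVal_le_one (EA := EA) y
    have := binVal_le_one (EA := EA) z
    rw [abs_le]
    constructor <;> norm_num <;> linarith
  | succ n ih =>
    have halve : ∀ s t : ℝ, |t| ≤ 2 * (1 / 2) ^ n → (s = t / 2 ∨ s = -(t / 2)) →
        |s| ≤ 2 * (1 / 2) ^ (n + 1) := by
      rintro s t ht (rfl | rfl) <;>
      · simp only [abs_neg, abs_div, pow_succ, abs_of_pos (show (0 : ℝ) < 2 by norm_num)]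
        linarith
    have two_halves : ∀ x y z, EA.Tri x y z → EA.Half z → EA.Half x →
        |EA.binVal x + EA.binVal y + EA.binVal z - 1| ≤ 2 * (1 / 2) ^ (n + 1) := by
      intro x y z h hz hx
      have h1 : EA.le z x := EA.le_trans' (EA.le_of_add' h.rotate.add_eq) hx
      have h2 : EA.le x z := EA.le_trans' (EA.le_of_add h.add_eq) hz
      obtain rfl := EA.le_antisymm' h1 h2
      have hy := h.add_eq
      rw [EA.le_antisymm' hz (EA.le_of_add hy)] at hy
      rw [EA.add_left_cancel hy (EA.add_zero z), binVal_zero h01]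
      have := binVal_orthosupp htot h01 z
      rw [EA.le_antisymm' hz (EA.le_of_add h.add_eq)] at this
      rw [show EA.binVal z + 0 + EA.binVal z - 1 = 0 by linarith, abs_zero]
      positivity
    have one_half : ∀ x y z, EA.Tri x y z → EA.Half z →
        |EA.binVal x + EA.binVal y + EA.binVal z - 1| ≤ 2 * (1 / 2) ^ (n + 1) := by
      intro x y z h hz
      by_cases hx : EA.Half x
      · exact two_halves x y z h hz hx
      by_cases hy : EA.Half y
      · rw [_root_.add_comm (EA.binVal x)]
        exact two_halves y x z h.swap hz hy
      refine halve _ _ (ih _ _ _ (h.dbl_of_half htot hz hx hy)) (Or.inl ?_)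
      rw [binVal_of_not_half hx, binVal_of_not_half hy, binVal_of_half hz]
      ring
    have no_half : ∀ x y z, EA.Tri x y z → ¬ EA.Half x → ¬ EA.Half y → ¬ EA.Half z →
        EA.le x z → |EA.binVal x + EA.binVal y + EA.binVal z - 1| ≤ 2 * (1 / 2) ^ (n + 1) := by
      intro x y z h hx hy hz hxz
      refine halve _ _ (ih _ _ _ (h.orthosupp_dbl htot hx hy hz hxz)) (Or.inr ?_)
      rw [binVal_of_not_half hx, binVal_of_not_half hy, binVal_of_not_half hz,
        binVal_orthosupp htot h01, binVal_orthosupp htot h01, binVal_orthosupp htot h01]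
      ring
    intro x y z h
    by_cases hz : EA.Half z
    · exact one_half x y z h hz
    by_cases hx : EA.Half x
    · convert one_half y z x h.rotate hx using 2
      ring
    by_cases hy : EA.Half y
    · convert one_half z x y h.rotate.rotate hy using 2
      ring
    rcases htot x z with hxz | hxz
    · exact no_half x y z h hx hy hz hxz
    · convert no_half z y x h.rotate.swap hz hy hx hxz using 2
      ring

lemma binVal_add (htot : EA.Total) (h01 : EA.zero ≠ EA.one) (h : EA.add a b = some c) :
    EA.binVal c = EA.binVal a + EA.binVal b := by
  have h1 := eq_zero_of_abs_le fun n => abs_binVal_tri htot h01 n _ _ _ (EA.tri_of_add h)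
  rw [binVal_orthosupp htot h01] at h1
  linarith

/-- A nontrivial totally ordered effect algebra has a state. -/
theorem exists_state (htot : EA.Total) (h01 : EA.zero ≠ EA.one) :
    ∃ ω : E → ℝ, (∀ a, 0 ≤ ω a) ∧ ω EA.one = 1 ∧
      ∀ a b c, EA.add a b = some c → ω c = ω a + ω b :=
  ⟨EA.binVal, binVal_nonneg, binVal_one, fun _ _ _ => binVal_add htot h01⟩

end Linear

end EffectAlgebra

/-- A complete MV-algebra with truncated addition and truncated subtraction. -/
class CompleteMV (M : Type*) extends CompleteLattice M, AddCommMonoid M, Sub M where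
  add_le_add_left' : ∀ a b : M, a ≤ b → ∀ c, a + c ≤ b + c
  le_add : ∀ a b : M, a ≤ a + b
  sub_le_iff : ∀ a b c : M, a - b ≤ c ↔ a ≤ c + b
  sub_add_cancel_of_le : ∀ a b : M, b ≤ a → a - b + b = a
  sub_sub_eq_inf : ∀ a b : M, a - (a - b) = a ⊓ b

namespace CompleteMV

section Algebra

variable {M : Type*} [CompleteMV M] {a b c : M}

instance : IsOrderedAddMonoid M where
  add_le_add_left := add_le_add_left'

instance : CanonicallyOrderedAdd M where
  exists_add_of_le {a b} h := ⟨b - a, by rw [add_comm, sub_add_cancel_of_le _ _ h]⟩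
  le_add_self a b := by rw [add_comm]; exact le_add a b
  le_self_add := le_add

instance : OrderedSub M where
  tsub_le_iff_right := sub_le_iff

lemma sub_sub_of_le (h : b ≤ a) : a - (a - b) = b := by
  rw [sub_sub_eq_inf, inf_eq_right.2 h]

lemma top_sub_top_sub (a : M) : ⊤ - (⊤ - a) = a := sub_sub_of_le le_top

lemma top_sub_add (a b : M) : ⊤ - (a + b) = ⊤ - a - b := tsub_add_eq_tsub_tsub ..

lemma add_eq_top_sub (a b : M) : a + b = ⊤ - (⊤ - a - b) := by
  rw [← top_sub_add, top_sub_top_sub]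

lemma le_top_sub_comm : a ≤ ⊤ - b ↔ b ≤ ⊤ - a := by
  constructor <;> intro h
  · simpa only [top_sub_top_sub] using tsub_le_tsub_left h ⊤
  · simpa only [top_sub_top_sub] using tsub_le_tsub_left h ⊤

/-- The Łukasiewicz conjunction is commutative. -/
lemma sub_top_sub_comm (a b : M) : a - (⊤ - b) = b - (⊤ - a) := by
  conv_lhs => rw [← top_sub_top_sub a, tsub_right_comm, top_sub_top_sub]

lemma add_sub_eq_inf (a b : M) : a + b - b = a ⊓ (⊤ - b) := by
  rw [add_comm, add_eq_top_sub, tsub_right_comm, sub_sub_eq_inf, inf_comm]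

lemma add_sub_cancel_of_le (h : a ≤ ⊤ - b) : a + b - b = a := by
  rw [add_sub_eq_inf, inf_eq_left.2 h]

lemma sub_inf_self (a b : M) : a - a ⊓ b = a - b := by
  rw [← sub_sub_eq_inf, sub_sub_of_le tsub_le_self]

lemma inf_add_sub (a b : M) : a ⊓ b + (a - b) = a := by
  rw [← sub_inf_self, add_comm, sub_add_cancel_of_le _ _ inf_le_left]

lemma inf_le_top_sub_sub (a b : M) : a ⊓ b ≤ ⊤ - (a - b) := by
  rw [← sub_sub_eq_inf]
  exact tsub_le_tsub_right le_top _

lemma sub_inf_sub (a b : M) : (a - b) ⊓ (b - a) = 0 := by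
  set x := (a - b) ⊓ (b - a)
  have ha : a ⊓ b + x ≤ a := (add_le_add_right inf_le_left _).trans (inf_add_sub a b).le
  have hb : a ⊓ b + x ≤ b := by
    refine (add_le_add_right inf_le_right _).trans ?_
    rw [inf_comm, inf_add_sub]
  have hx : x ≤ ⊤ - a ⊓ b := by
    rw [le_top_sub_comm]
    exact (inf_le_top_sub_sub a b).trans (tsub_le_tsub_left inf_le_left _)
  rw [← add_sub_cancel_of_le hx, add_comm]
  exact tsub_eq_zero_of_le (le_inf ha hb)

lemma inf_add_eq_zero {x : M} (ha : x ⊓ a = 0) (hb : x ⊓ b = 0) : x ⊓ (a + b) = 0 := by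
  have h1 : x ⊓ (a + b) ≤ b := by
    have h2 : x ⊓ (a + b) ⊓ a = 0 :=
      le_antisymm ((inf_le_inf_right _ inf_le_left).trans ha.le) zero_le
    have h3 : x ⊓ (a + b) - a ≤ b := by
      rw [tsub_le_iff_left]
      exact inf_le_right
    rwa [← sub_inf_self, h2, tsub_zero] at h3
  exact le_antisymm ((le_inf inf_le_left h1).trans hb.le) zero_le

lemma nsmul_sub_eq_zero (h : ∀ n : ℕ, n • a ≤ ⊤ - a) : a = 0 := by
  set s := ⨆ n : ℕ, n • a
  have hs : s ≤ s - a := by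
    refine iSup_le fun n => ?_
    rw [← add_sub_cancel_of_le (h n), ← succ_nsmul]
    exact tsub_le_tsub_right (le_iSup (fun n : ℕ => n • a) (n + 1)) a
  have ha : a ≤ s := by simpa using le_iSup (fun n : ℕ => n • a) 1
  rw [← sub_sub_of_le ha, tsub_eq_zero_of_le hs]

end Algebra

section PrimeIdeal

variable (M : Type*) [CompleteMV M]

/-- A proper prime ideal of an MV-algebra. -/
structure PrimeIdeal where
  carrier : Set M
  lower : ∀ {a b}, a ≤ b → b ∈ carrier → a ∈ carrier
  zero_mem : (0 : M) ∈ carrier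
  top_notMem : (⊤ : M) ∉ carrier
  add_mem : ∀ {a b}, a ∈ carrier → b ∈ carrier → a + b ∈ carrier
  mem_or_mem : ∀ {a b}, a ⊓ b = 0 → a ∈ carrier ∨ b ∈ carrier

variable {M} {a b c : M}

/-- Every nonzero element avoids some prime ideal. -/
lemma exists_primeIdeal {d : M} (hd : d ≠ 0) : ∃ P : PrimeIdeal M, d ∉ P.carrier := by
  -- a maximal filter of nonzero elements containing `d`
  let F : Set (Set M) := {U | (∀ x ∈ U, ∀ y ∈ U, x ⊓ y ∈ U) ∧ (∀ x ∈ U, ∀ y, x ≤ y → y ∈ U) ∧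
    (0 : M) ∉ U}
  have hF : Set.Ici d ∈ F := by
    refine ⟨fun x hx y hy => le_inf hx hy, fun x hx y hxy => le_trans hx hxy, fun h => hd ?_⟩
    exact le_antisymm h zero_le
  obtain ⟨U, hdU, hU⟩ := zorn_subset_nonempty F (by
    intro c hc hch hne
    refine ⟨⋃₀ c, ⟨?_, ?_, ?_⟩, fun s hs => Set.subset_sUnion_of_mem hs⟩
    · rintro x ⟨s, hs, hx⟩ y ⟨t, ht, hy⟩
      rcases hch.total hs ht with h | h
      · exact ⟨t, ht, (hc ht).1 x (h hx) y hy⟩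
      · exact ⟨s, hs, (hc hs).1 x hx y (h hy)⟩
    · rintro x ⟨s, hs, hx⟩ y hxy
      exact ⟨s, hs, (hc hs).2.1 x hx y hxy⟩
    · rintro ⟨s, hs, h0⟩
      exact (hc hs).2.2 h0) _ hF
  obtain ⟨hinf, hup, h0⟩ := hU.prop
  have hd' : d ∈ U := hdU le_rfl
  have hmax : ∀ a, a ∉ U ↔ ∃ u ∈ U, u ⊓ a = 0 := by
    intro a
    constructor
    · intro ha
      by_contra! hcon
      apply ha
      have : {x | ∃ u ∈ U, u ⊓ a ≤ x} ∈ F := by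
        refine ⟨?_, ?_, ?_⟩
        · rintro x ⟨u, hu, hx⟩ y ⟨v, hv, hy⟩
          refine ⟨u ⊓ v, hinf u hu v hv, le_inf ?_ ?_⟩
          · exact (inf_le_inf_right _ inf_le_left).trans hx
          · exact (inf_le_inf_right _ inf_le_right).trans hy
        · rintro x ⟨u, hu, hx⟩ y hxy
          exact ⟨u, hu, hx.trans hxy⟩
        · rintro ⟨u, hu, hx⟩
          exact hcon u hu (le_antisymm hx zero_le)
      exact hU.le_of_ge this (fun x hx => ⟨x, hx, inf_le_left⟩) ⟨d, hd', inf_le_right⟩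
    · rintro ⟨u, hu, hua⟩ ha
      exact h0 (hua ▸ hinf u hu a ha)
  refine ⟨⟨Uᶜ, fun h hb ha => hb (hup _ ha _ h), h0, fun h => h (hup d hd' _ le_top),
    ?_, ?_⟩, fun h => h hd'⟩
  · intro a b ha hb
    obtain ⟨u, hu, hua⟩ := (hmax a).1 ha
    obtain ⟨v, hv, hvb⟩ := (hmax b).1 hb
    refine (hmax _).2 ⟨u ⊓ v, hinf u hu v hv, inf_add_eq_zero ?_ ?_⟩
    · exact le_antisymm ((inf_le_inf_right _ inf_le_left).trans hua.le) zero_le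
    · exact le_antisymm ((inf_le_inf_right _ inf_le_right).trans hvb.le) zero_le
  · intro a b hab
    by_contra! h
    simp only [Set.mem_compl_iff, not_not] at h
    exact h0 (hab ▸ hinf a h.1 b h.2)

namespace PrimeIdeal

variable (P : PrimeIdeal M)

lemma sub_mem_trans (h : a - b ∈ P.carrier) (h' : b - c ∈ P.carrier) : a - c ∈ P.carrier :=
  P.lower tsub_le_tsub_add_tsub (P.add_mem h h')

/-- Congruence modulo a prime ideal. -/
def setoid : Setoid M where
  r a b := a - b ∈ P.carrier ∧ b - a ∈ P.carrier
  iseqv := by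
    refine ⟨fun a => ?_, fun h => h.symm, fun h h' => ⟨P.sub_mem_trans h.1 h'.1,
      P.sub_mem_trans h'.2 h.2⟩⟩
    rw [tsub_self]
    exact ⟨P.zero_mem, P.zero_mem⟩

lemma sub_mem_congr {a' b' : M} (ha : a - a' ∈ P.carrier) (hb : b' - b ∈ P.carrier)
    (h : a' - b' ∈ P.carrier) : a - b ∈ P.carrier :=
  P.sub_mem_trans ha (P.sub_mem_trans h hb)

lemma add_sub_add_mem {a' b' : M} (ha : a - a' ∈ P.carrier) (hb : b - b' ∈ P.carrier) :
    (a + b) - (a' + b') ∈ P.carrier :=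
  P.lower add_tsub_add_le_tsub_add_tsub (P.add_mem ha hb)

lemma top_sub_sub_mem {a' : M} (ha : a - a' ∈ P.carrier) :
    (⊤ - a') - (⊤ - a) ∈ P.carrier := by
  rwa [sub_top_sub_comm, top_sub_top_sub]

open Classical in
/-- Partial addition on the quotient by a prime ideal. -/
noncomputable def quotAdd : Quotient P.setoid → Quotient P.setoid → Option (Quotient P.setoid) :=
  Quotient.lift₂ (fun a b => if a - (⊤ - b) ∈ P.carrier then some ⟦a + b⟧ else none) (by
    intro a b a' b' ha hb
    have h : (⟦a + b⟧ : Quotient P.setoid) = ⟦a' + b'⟧ :=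
      Quotient.sound ⟨P.add_sub_add_mem ha.1 hb.1, P.add_sub_add_mem ha.2 hb.2⟩
    have h2 : a - (⊤ - b) ∈ P.carrier ↔ a' - (⊤ - b') ∈ P.carrier :=
      ⟨P.sub_mem_congr ha.2 (P.top_sub_sub_mem hb.2),
        P.sub_mem_congr ha.1 (P.top_sub_sub_mem hb.1)⟩
    simp only [h, h2])

lemma quotAdd_of_mem (h : a - (⊤ - b) ∈ P.carrier) : P.quotAdd ⟦a⟧ ⟦b⟧ = some ⟦a + b⟧ :=
  if_pos h

lemma quotAdd_of_notMem (h : a - (⊤ - b) ∉ P.carrier) : P.quotAdd ⟦a⟧ ⟦b⟧ = none :=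
  if_neg h

lemma quotAdd_eq_some {x : Quotient P.setoid} (h : P.quotAdd ⟦a⟧ ⟦b⟧ = some x) :
    a - (⊤ - b) ∈ P.carrier ∧ x = ⟦a + b⟧ := by
  by_cases hm : a - (⊤ - b) ∈ P.carrier
  · rw [P.quotAdd_of_mem hm] at h
    exact ⟨hm, (Option.some_injective _ h).symm⟩
  · rw [P.quotAdd_of_notMem hm] at h
    cases h

lemma sub_mem_of_add_sub_mem (h : a - (⊤ - b) ∈ P.carrier) (h' : a + b - (⊤ - c) ∈ P.carrier) :
    b - (⊤ - c) ∈ P.carrier ∧ a - (⊤ - (b + c)) ∈ P.carrier := by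
  refine ⟨P.lower (tsub_le_tsub_right le_add_self _) h', ?_⟩
  have h1 : a - (a + b - b) ∈ P.carrier := by rwa [add_sub_eq_inf, sub_inf_self]
  refine P.sub_mem_trans h1 (P.lower ?_ h')
  rw [add_comm b c, top_sub_add]
  rw [tsub_le_iff_right]
  exact tsub_le_tsub_add_tsub

/-- The quotient of an MV-algebra by a prime ideal, as an effect algebra. -/
noncomputable def quotient : EffectAlgebra (Quotient P.setoid) where
  add := P.quotAdd
  zero := ⟦0⟧
  one := ⟦⊤⟧
  comm := by
    rintro ⟨a⟩ ⟨b⟩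
    change P.quotAdd ⟦a⟧ ⟦b⟧ = P.quotAdd ⟦b⟧ ⟦a⟧
    by_cases h : a - (⊤ - b) ∈ P.carrier
    · rw [P.quotAdd_of_mem h, P.quotAdd_of_mem (sub_top_sub_comm a b ▸ h), add_comm]
    · rw [P.quotAdd_of_notMem h, P.quotAdd_of_notMem (sub_top_sub_comm a b ▸ h)]
  assoc := by
    rintro ⟨a⟩ ⟨b⟩ ⟨c⟩
    change (P.quotAdd ⟦a⟧ ⟦b⟧).bind (fun d => P.quotAdd d ⟦c⟧) =
      (P.quotAdd ⟦b⟧ ⟦c⟧).bind (fun d => P.quotAdd ⟦a⟧ d)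
    ext x
    simp only [Option.bind_eq_some_iff]
    constructor
    · rintro ⟨d, hd, hx⟩
      obtain ⟨h1, rfl⟩ := P.quotAdd_eq_some hd
      obtain ⟨h2, rfl⟩ := P.quotAdd_eq_some hx
      obtain ⟨h3, h4⟩ := P.sub_mem_of_add_sub_mem h1 h2
      exact ⟨_, P.quotAdd_of_mem h3, by rw [P.quotAdd_of_mem h4, add_assoc]⟩
    · rintro ⟨d, hd, hx⟩
      obtain ⟨h1, rfl⟩ := P.quotAdd_eq_some hd
      obtain ⟨h2, rfl⟩ := P.quotAdd_eq_some hx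
      rw [sub_top_sub_comm] at h1 h2
      rw [add_comm b c] at h2
      obtain ⟨h3, h4⟩ := P.sub_mem_of_add_sub_mem h1 h2
      rw [sub_top_sub_comm] at h3 h4
      rw [add_comm b a] at h4
      exact ⟨_, P.quotAdd_of_mem h3, by rw [P.quotAdd_of_mem h4, add_assoc]⟩
  orth := by
    rintro ⟨a⟩
    refine ⟨⟦⊤ - a⟧, ?_, ?_⟩
    · change P.quotAdd ⟦a⟧ ⟦⊤ - a⟧ = some ⟦⊤⟧
      rw [P.quotAdd_of_mem, add_tsub_cancel_of_le le_top]
      rw [top_sub_top_sub, tsub_self]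
      exact P.zero_mem
    · rintro ⟨b⟩ hb
      change P.quotAdd ⟦a⟧ ⟦b⟧ = some ⟦⊤⟧ at hb
      obtain ⟨h1, h2⟩ := P.quotAdd_eq_some hb
      have h3 := (Quotient.exact h2).1
      refine Quotient.sound ⟨?_, ?_⟩
      · rwa [sub_top_sub_comm]
      · rwa [← top_sub_add]
  pos_one := by
    rintro ⟨a⟩ ⟨b⟩ h
    change P.quotAdd ⟦a⟧ ⟦⊤⟧ = some _ at h
    obtain ⟨h1, -⟩ := P.quotAdd_eq_some h
    rw [tsub_self, tsub_zero] at h1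
    refine Quotient.sound ⟨by rwa [tsub_zero], ?_⟩
    rw [zero_tsub]
    exact P.zero_mem

lemma quotient_le (h : a - b ∈ P.carrier) : P.quotient.le ⟦a⟧ ⟦b⟧ := by
  refine ⟨⟦b - a⟧, ?_⟩
  change P.quotAdd ⟦a⟧ ⟦b - a⟧ = some ⟦b⟧
  rw [P.quotAdd_of_mem]
  · refine congrArg some (Quotient.sound ⟨?_, ?_⟩)
    · refine P.lower ?_ h
      rw [tsub_le_iff_right]
      calc a + (b - a) ≤ a + (a - b + b - a) := by gcongr; exact le_add_self
        _ = a - b + b := add_tsub_cancel_of_le le_tsub_add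
    · rw [tsub_eq_zero_of_le le_add_tsub]
      exact P.zero_mem
  · rw [tsub_eq_zero_of_le (le_top_sub_comm.1 (tsub_le_tsub_right le_top a))]
    exact P.zero_mem

lemma quotient_total : P.quotient.Total := by
  rintro ⟨a⟩ ⟨b⟩
  exact (P.mem_or_mem (sub_inf_sub a b)).imp P.quotient_le P.quotient_le

end PrimeIdeal

end PrimeIdeal

section State

variable (M : Type*) [CompleteMV M]

/-- The `[0, 1]`-valued homomorphisms of an MV-algebra. -/
def states : Set (M → ℝ) :=
  {ω | (∀ a, ω a ∈ Set.Icc 0 1) ∧ ω ⊤ = 1 ∧ (∀ a b, a ≤ ⊤ - b → ω (a + b) = ω a + ω b) ∧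
    ∀ a b, ω (a ⊓ b) = min (ω a) (ω b)}

variable {M} {a b c : M} (ω : states M)

lemma state_nonneg (a : M) : 0 ≤ ω.1 a := (ω.2.1 a).1

lemma state_le_one (a : M) : ω.1 a ≤ 1 := (ω.2.1 a).2

lemma state_top : ω.1 ⊤ = 1 := ω.2.2.1

lemma state_add_of_le (h : a ≤ ⊤ - b) : ω.1 (a + b) = ω.1 a + ω.1 b := ω.2.2.2.1 a b h

lemma state_inf (a b : M) : ω.1 (a ⊓ b) = min (ω.1 a) (ω.1 b) := ω.2.2.2.2 a b

lemma state_mono (h : a ≤ b) : ω.1 a ≤ ω.1 b := by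
  have := state_inf ω a b
  rw [inf_eq_left.2 h] at this
  exact this ▸ min_le_right _ _

lemma state_sub (a b : M) : ω.1 (a - b) = ω.1 a - min (ω.1 a) (ω.1 b) := by
  have h := state_add_of_le ω (inf_le_top_sub_sub a b)
  rw [inf_add_sub, state_inf] at h
  linarith

lemma state_top_sub (a : M) : ω.1 (⊤ - a) = 1 - ω.1 a := by
  rw [state_sub, state_top, min_eq_right (state_le_one ω a)]

lemma state_add (a b : M) : ω.1 (a + b) = min 1 (ω.1 a + ω.1 b) := by
  rw [add_eq_top_sub, state_top_sub, state_sub, state_top_sub]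
  rcases le_total 1 (ω.1 a + ω.1 b) with h | h
  · rw [min_eq_left h, min_eq_left (by linarith)]
    ring
  · rw [min_eq_right h, min_eq_right (by linarith)]
    ring

lemma state_zero : ω.1 0 = 0 := by
  have := state_top_sub ω ⊤
  rwa [tsub_self, state_top, sub_self] at this

lemma state_nsmul (n : ℕ) (a : M) : ω.1 (n • a) = min 1 (n * ω.1 a) := by
  induction n with
  | zero => simp [state_zero]
  | succ n ih =>
    rw [succ_nsmul, state_add, ih]
    have := state_nonneg ω a
    push_cast
    rcases le_total 1 (n * ω.1 a) with h | h
    · rw [min_eq_left h, min_eq_left (by linarith), min_eq_left (by linarith)]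
    · rw [min_eq_right h]
      ring_nf

lemma exists_state_of_primeIdeal (P : PrimeIdeal M) :
    ∃ ω : states M, ∀ a ∈ P.carrier, ω.1 a = 0 := by
  obtain ⟨ω, h0, h1, hadd⟩ := EffectAlgebra.exists_state P.quotient_total (fun h => by
    have := (Quotient.exact h).2
    rw [tsub_zero] at this
    exact P.top_notMem this)
  let ν : M → ℝ := fun a => ω ⟦a⟧
  have hν : ∀ a b, a - (⊤ - b) ∈ P.carrier → ν (a + b) = ν a + ν b := fun a b h =>
    hadd _ _ _ (P.quotAdd_of_mem h)
  have hexact : ∀ a b, a ≤ ⊤ - b → ν (a + b) = ν a + ν b := fun a b h => hν a b (by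
    rw [tsub_eq_zero_of_le h]
    exact P.zero_mem)
  have hmono : ∀ a b, a ≤ b → ν a ≤ ν b := fun a b h => by
    have := hexact (a ⊓ b) (b - a) (by rw [inf_comm]; exact inf_le_top_sub_sub b a)
    rw [inf_comm, inf_add_sub, inf_eq_right.2 h] at this
    have := h0 ⟦b - a⟧
    change 0 ≤ ν (b - a) at this
    linarith
  have hz : ν 0 = 0 := by
    have := hexact 0 0 zero_le
    rw [add_zero] at this
    linarith
  have hP : ∀ a ∈ P.carrier, ν a = 0 := fun a ha => by
    rw [← hz]
    refine congrArg ω (Quotient.sound ⟨?_, ?_⟩)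
    · rwa [tsub_zero]
    · rw [zero_tsub]
      exact P.zero_mem
  have hinf : ∀ a b, a - b ∈ P.carrier → ν (a ⊓ b) = min (ν a) (ν b) := fun a b h => by
    have h2 := hexact _ _ (inf_le_top_sub_sub a b)
    rw [inf_add_sub, hP _ h, add_zero] at h2
    rw [h2, min_eq_left (hmono _ _ inf_le_right)]
  refine ⟨⟨ν, fun a => ⟨h0 _, h1 ▸ hmono a ⊤ le_top⟩, h1, hexact, fun a b => ?_⟩, hP⟩
  rcases P.mem_or_mem (sub_inf_sub a b) with h | h
  · exact hinf a b h
  · rw [inf_comm, min_comm]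
    exact hinf b a h

lemma exists_state_pos (ha : a ≠ 0) : ∃ ω : states M, 0 < ω.1 a := by
  obtain ⟨n, hn⟩ : ∃ n : ℕ, ¬ n • a ≤ ⊤ - a := by
    by_contra! h
    exact ha (nsmul_sub_eq_zero h)
  have hd : n • a - (⊤ - a) ≠ 0 := fun h => hn (tsub_eq_zero_iff_le.1 h)
  obtain ⟨P, hP⟩ := exists_primeIdeal hd
  obtain ⟨ω, hω⟩ := exists_state_of_primeIdeal P
  refine ⟨ω, (state_nonneg ω a).lt_of_ne' fun h0 => ?_⟩
  have h1 : ⊤ - (n • a) - a ∈ P.carrier := by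
    rw [tsub_right_comm]
    exact (P.mem_or_mem (sub_inf_sub (n • a) (⊤ - a))).resolve_left hP
  have h2 := hω _ h1
  rw [← top_sub_add, ← succ_nsmul, state_top_sub, state_nsmul, h0] at h2
  norm_num at h2

/-- States separate the order. -/
lemma exists_state_lt (h : ¬ a ≤ b) : ∃ ω : states M, ω.1 b < ω.1 a := by
  obtain ⟨ω, hω⟩ := exists_state_pos (a := a - b) fun h' => h (tsub_eq_zero_iff_le.1 h')
  rw [state_sub] at hω
  refine ⟨ω, ?_⟩
  by_contra! hle
  rw [min_eq_left hle] at hω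
  linarith

end State

end CompleteMV

namespace CompleteMV

section Topology

open Filter Topology

variable {M : Type*} [CompleteMV M] {a b c : M}

lemma continuous_state (a : M) : Continuous fun ω : states M => ω.1 a :=
  (continuous_apply a).comp continuous_subtype_val

lemma isClosed_states : IsClosed (states M) := by
  simp only [states, Set.ofPred_and, Set.ofPred_forall]
  refine .inter (isClosed_iInter fun a => isClosed_Icc.preimage (continuous_apply a)) (.inter
    (isClosed_eq (continuous_apply _) continuous_const) (.inter ?_ ?_))
  · exact isClosed_iInter fun a => isClosed_iInter fun b => isClosed_iInter fun _ =>
      isClosed_eq (continuous_apply _) ((continuous_apply a).add (continuous_apply b))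
  · exact isClosed_iInter fun a => isClosed_iInter fun b =>
      isClosed_eq (continuous_apply _) ((continuous_apply a).min (continuous_apply b))

instance : CompactSpace (states M) :=
  isCompact_iff_compactSpace.1 <| (isCompact_univ_pi fun _ : M => isCompact_Icc).of_isClosed_subset
    isClosed_states fun _ h a _ => h.1 a

lemma exists_threshold (n : ℕ) (a : M) (k : ℤ) :
    ∃ d : M, ∀ ω : states M, 0 < ω.1 d ↔ (k : ℝ) / 2 ^ n < ω.1 a := by
  induction n generalizing a k with
  | zero =>
    simp only [pow_zero, div_one]
    rcases lt_trichotomy k 0 with hk | rfl | hk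
    · refine ⟨⊤, fun ω => iff_of_true (by rw [state_top]; norm_num) ?_⟩
      exact lt_of_lt_of_le (by exact_mod_cast hk) (state_nonneg ω a)
    · exact ⟨a, fun ω => by simp⟩
    · refine ⟨0, fun ω => iff_of_false (by rw [state_zero]; norm_num) ?_⟩
      have : (1 : ℝ) ≤ k := by exact_mod_cast hk
      exact ((state_le_one ω a).trans this).not_gt
  | succ n ih =>
    have h2 : (0 : ℝ) < 2 ^ n := by positivity
    rcases lt_or_ge k (2 ^ n) with hk | hk
    · obtain ⟨d, hd⟩ := ih (a + a) k
      refine ⟨d, fun ω => ?_⟩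
      have hk' : (k : ℝ) / 2 ^ n < 1 := by
        rw [div_lt_one h2]
        exact_mod_cast hk
      rw [hd, state_add, lt_min_iff, and_iff_right hk', pow_succ, ← div_div,
        div_lt_iff₀ (c := (2 : ℝ)) two_pos, mul_two]
    · obtain ⟨d, hd⟩ := ih (a - (⊤ - a)) (k - 2 ^ n)
      refine ⟨d, fun ω => ?_⟩
      have hk' : 1 ≤ (k : ℝ) / 2 ^ n := by
        rw [one_le_div h2]
        exact_mod_cast hk
      rw [hd, state_sub, state_top_sub, pow_succ, ← div_div, div_lt_iff₀ (c := (2 : ℝ)) two_pos,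
        mul_two]
      push_cast
      rw [sub_div, div_self h2.ne']
      rcases le_total (ω.1 a) (1 - ω.1 a) with h | h
      · rw [min_eq_left h]
        constructor <;> intro <;> linarith
      · rw [min_eq_right h]
        constructor <;> intro <;> linarith

lemma exists_pos_subset_Ioi {r : ℝ} (ω₀ : states M) (h : r < ω₀.1 a) :
    ∃ c : M, 0 < ω₀.1 c ∧ ∀ ω : states M, 0 < ω.1 c → r < ω.1 a := by
  obtain ⟨n, hn⟩ := exists_pow_lt_of_lt_one (sub_pos.2 h) (one_half_lt_one (α := ℝ))
  have h2 : (0 : ℝ) < 2 ^ n := by positivity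
  rw [one_div, inv_pow, ← one_div, div_lt_iff₀ h2, sub_mul] at hn
  obtain ⟨d, hd⟩ := exists_threshold n a ⌈r * 2 ^ n⌉
  refine ⟨d, (hd _).2 ?_, fun ω hω => lt_of_le_of_lt ?_ ((hd _).1 hω)⟩
  · rw [div_lt_iff₀ h2]
    linarith [Int.ceil_lt_add_one (r * 2 ^ n)]
  · rw [le_div_iff₀ h2]
    exact Int.le_ceil _

lemma exists_pos_subset_Ioo {r s : ℝ} (ω₀ : states M) (h : ω₀.1 a ∈ Set.Ioo r s) :
    ∃ c : M, 0 < ω₀.1 c ∧ ∀ ω : states M, 0 < ω.1 c → ω.1 a ∈ Set.Ioo r s := by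
  obtain ⟨c, hc0, hc⟩ := exists_pos_subset_Ioi ω₀ h.1
  obtain ⟨d, hd0, hd⟩ := exists_pos_subset_Ioi (a := ⊤ - a) (r := 1 - s) ω₀
    (by rw [state_top_sub]; linarith [h.2])
  refine ⟨c ⊓ d, by rw [state_inf]; exact lt_min hc0 hd0, fun ω hω => ?_⟩
  rw [state_inf, lt_min_iff] at hω
  have := hd ω hω.2
  rw [state_top_sub] at this
  exact ⟨hc ω hω.1, by linarith⟩

/-- The sets `{ω | 0 < ω c}` form a basis of the topology on the space of states. -/
lemma exists_pos_subset {W : Set (states M)} (hW : IsOpen W) {ω₀ : states M} (h : ω₀ ∈ W) :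
    ∃ c : M, 0 < ω₀.1 c ∧ ∀ ω : states M, 0 < ω.1 c → ω ∈ W := by
  obtain ⟨U, hU, rfl⟩ := isOpen_induced_iff.1 hW
  obtain ⟨I, u, hu, hI⟩ := isOpen_pi_iff.1 hU ω₀.1 h
  have key : ∀ a : M, ∃ c : M, 0 < ω₀.1 c ∧ (a ∈ I → ∀ ω : states M, 0 < ω.1 c → ω.1 a ∈ u a) := by
    intro a
    by_cases ha : a ∈ I
    · obtain ⟨ε, hε, hball⟩ := Metric.isOpen_iff.1 (hu a ha).1 _ (hu a ha).2
      rw [Real.ball_eq_Ioo] at hball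
      obtain ⟨c, hc0, hc⟩ := exists_pos_subset_Ioo (a := a) (r := ω₀.1 a - ε) (s := ω₀.1 a + ε) ω₀
        ⟨by linarith, by linarith⟩
      exact ⟨c, hc0, fun _ ω hω => hball (hc ω hω)⟩
    · exact ⟨⊤, by rw [state_top]; norm_num, fun h => absurd h ha⟩
  choose c hc0 hc using key
  refine ⟨I.inf c, ?_, fun ω hω => hI fun a ha => hc a ha ω ?_⟩
  · clear hc hI hu
    induction I using Finset.cons_induction with
    | empty => rw [Finset.inf_empty, state_top]; norm_num
    | cons a I ha ih => rw [Finset.inf_cons, state_inf]; exact lt_min (hc0 a) ih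
  · exact hω.trans_le (state_mono ω (Finset.inf_le ha))

lemma le_of_eventually_residual (h : ∀ᶠ ω in residual (states M), ω.1 a ≤ ω.1 b) : a ≤ b := by
  by_contra hab
  obtain ⟨ω₀, h₀⟩ := exists_state_lt hab
  have ho : IsOpen {ω : states M | ω.1 b < ω.1 a} :=
    isOpen_lt (continuous_state b) (continuous_state a)
  obtain ⟨ω, h1, h2⟩ := (dense_of_mem_residual h).inter_open_nonempty _ ho ⟨ω₀, h₀⟩
  exact not_le_of_gt (show ω.1 b < ω.1 a from h1) h2

lemma eq_of_eventually_residual (h : ∀ᶠ ω in residual (states M), ω.1 a = ω.1 b) : a = b :=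
  (le_of_eventually_residual (h.mono fun _ => le_of_eq)).antisymm
    (le_of_eventually_residual (h.mono fun _ => ge_of_eq))

lemma add_iInf_le {ι : Sort*} (x : M) (f : ι → M) : ⨅ i, (x + f i) ≤ x + ⨅ i, f i := by
  rw [← tsub_le_iff_left]
  exact le_iInf fun i => tsub_le_iff_left.2 (iInf_le _ i)

lemma iInf_nsmul_eq_zero {f : ℕ → M} (hf : Antitone f) (h : ⨅ n, f n = 0) (k : ℕ) :
    ⨅ n, k • f n = 0 := by
  induction k with
  | zero => simp
  | succ k ih =>
    refine le_antisymm ?_ zero_le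
    calc ⨅ n, (k + 1) • f n ≤ ⨅ n, (⨅ m, (k • f n + f m)) := by
          refine le_iInf fun n => le_iInf fun m => (iInf_le _ (max n m)).trans ?_
          rw [succ_nsmul]
          exact add_le_add (nsmul_le_nsmul_right (hf (le_max_left n m)) k) (hf (le_max_right n m))
      _ ≤ ⨅ n, (k • f n + ⨅ m, f m) := iInf_mono fun n => add_iInf_le _ _
      _ = 0 := by rw [h]; simpa using ih

/-- States are residually continuous along decreasing sequences with infimum zero. -/
lemma tendsto_zero_of_iInf_eq_zero {f : ℕ → M} (hf : Antitone f) (h : ⨅ n, f n = 0) :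
    ∀ᶠ ω in residual (states M), Tendsto (fun n => ω.1 (f n)) atTop (𝓝 0) := by
  have key : ∀ k : ℕ, ∀ᶠ ω in residual (states M), ∃ n, ((k : ℝ) + 1) * ω.1 (f n) < 1 := by
    intro k
    have ho : IsOpen {ω : states M | ∃ n, ((k : ℝ) + 1) * ω.1 (f n) < 1} := by
      simp only [Set.ofPred_exists]
      exact isOpen_iUnion fun n => isOpen_lt (continuous_const.mul (continuous_state _))
        continuous_const
    refine residual_of_dense_open ho (dense_iff_inter_open.2 fun W hW ⟨ω₀, hω₀⟩ => ?_)
    by_contra hne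
    obtain ⟨c, hc0, hc⟩ := exists_pos_subset hW hω₀
    have hle : ∀ n, c ≤ (k + 1) • f n := by
      intro n
      by_contra hn
      obtain ⟨ω, hω⟩ := exists_state_lt hn
      refine hne ⟨ω, hc ω ((state_nonneg _ _).trans_lt hω), n, ?_⟩
      rw [state_nsmul] at hω
      rcases min_lt_iff.1 (hω.trans_le (state_le_one ω c)) with h' | h'
      · exact absurd h' (lt_irrefl _)
      · exact_mod_cast h'
    have := (le_iInf hle).trans_eq (iInf_nsmul_eq_zero hf h (k + 1))
    rw [le_antisymm this zero_le, state_zero] at hc0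
    exact lt_irrefl _ hc0
  filter_upwards [eventually_countable_forall.2 key] with ω hω
  have hanti : Antitone fun n => ω.1 (f n) := fun m n hmn => state_mono ω (hf hmn)
  refine Metric.tendsto_atTop.2 fun ε hε => ?_
  obtain ⟨k, hk⟩ := exists_nat_one_div_lt hε
  obtain ⟨n, hn⟩ := hω k
  refine ⟨n, fun m hm => ?_⟩
  rw [Real.dist_0_eq_abs, abs_of_nonneg (state_nonneg _ _)]
  refine (hanti hm).trans_lt (lt_trans ?_ hk)
  rw [lt_div_iff₀ (by positivity)]
  linarith

/-- States are residually continuous along increasing sequences. -/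
lemma tendsto_iSup {f : ℕ → M} (hf : Monotone f) :
    ∀ᶠ ω in residual (states M), Tendsto (fun n => ω.1 (f n)) atTop (𝓝 (ω.1 (⨆ n, f n))) := by
  set s := ⨆ n, f n
  have h : ⨅ n, (s - f n) = 0 := by
    have hle : s ≤ s - ⨅ n, (s - f n) := iSup_le fun n => by
      rw [← sub_sub_of_le (le_iSup f n)]
      exact tsub_le_tsub_left (iInf_le (fun n => s - f n) n) s
    have hs : ⨅ n, (s - f n) ≤ s := (iInf_le (fun n => s - f n) 0).trans tsub_le_self
    rw [← sub_sub_of_le hs, tsub_eq_zero_of_le hle]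
  filter_upwards [tendsto_zero_of_iInf_eq_zero (fun m n hmn => tsub_le_tsub_left (hf hmn) s) h]
    with ω hω
  have := hω.const_sub (ω.1 s)
  rw [sub_zero] at this
  refine this.congr fun n => ?_
  rw [state_sub, min_eq_right (state_mono ω (le_iSup f n))]
  ring

end Topology

end CompleteMV

namespace CompleteMV

section Measure

open Filter Topology MeasureTheory

variable {M : Type*} [CompleteMV M]

/-- `a` represents the measure of `A` at residually many states. -/
def Represents (μ : states M → Measure ℝ) (A : Set ℝ) (a : M) : Prop :=
  ∀ᶠ ω in residual (states M), (μ ω).real A = ω.1 a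

variable {μ : states M → Measure ℝ} {A B : Set ℝ} {a b : M}

lemma Represents.unique (ha : Represents μ A a) (hb : Represents μ A b) : a = b :=
  eq_of_eventually_residual (by filter_upwards [ha, hb] with ω h1 h2 using h1.symm.trans h2)

lemma represents_empty : Represents μ ∅ 0 :=
  Eventually.of_forall fun ω => by rw [measureReal_empty, state_zero]

variable [∀ ω, IsProbabilityMeasure (μ ω)]

lemma Represents.mono (ha : Represents μ A a) (hb : Represents μ B b) (h : A ⊆ B) : a ≤ b :=
  le_of_eventually_residual (by
    filter_upwards [ha, hb] with ω h1 h2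
    rw [← h1, ← h2]
    exact measureReal_mono h)

lemma represents_univ : Represents μ Set.univ ⊤ :=
  Eventually.of_forall fun ω => by rw [probReal_univ, state_top]

lemma Represents.compl (ha : Represents μ A a) (hA : MeasurableSet A) :
    Represents μ Aᶜ (⊤ - a) := by
  filter_upwards [ha] with ω h
  rw [probReal_compl_eq_one_sub hA, state_top_sub, h]

lemma Represents.union (ha : Represents μ A a) (hb : Represents μ B b) (hB : MeasurableSet B)
    (h : Disjoint A B) : Represents μ (A ∪ B) (a + b) := by
  filter_upwards [ha, hb] with ω h1 h2
  rw [state_add, ← h1, ← h2, ← measureReal_union h hB, min_eq_right measureReal_le_one]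

lemma Represents.iUnion {f : ℕ → Set ℝ} {a : ℕ → M} (h : ∀ n, Represents μ (f n) (a n))
    (hf : Monotone f) : Represents μ (⋃ n, f n) (⨆ n, a n) := by
  filter_upwards [eventually_countable_forall.2 h,
    tendsto_iSup fun m n hmn => (h m).mono (h n) (hf hmn)] with ω h1 h2
  refine tendsto_nhds_unique ?_ h2
  refine Tendsto.congr h1 ?_
  exact (ENNReal.tendsto_toReal (measure_ne_top _ _)).comp (tendsto_measure_iUnion_atTop hf)

lemma exists_represents {F : ℝ → M} (hF : ∀ t, Represents μ (Set.Iio t) (F t))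
    (hA : MeasurableSet A) : ∃ a, Represents μ A a := by
  induction A, hA using MeasurableSpace.induction_on_inter
    (BorelSpace.measurable_eq.trans (borel_eq_generateFrom_Iio ℝ)) isPiSystem_Iio with
  | empty => exact ⟨0, represents_empty⟩
  | basic t ht =>
    obtain ⟨s, rfl⟩ := ht
    exact ⟨_, hF s⟩
  | compl t ht ih =>
    obtain ⟨a, ha⟩ := ih
    exact ⟨_, ha.compl ht⟩
  | iUnion f hd hm ih =>
    have key : ∀ n, ∃ a, Represents μ (Set.accumulate f n) a := by
      intro n
      induction n with
      | zero => simpa using ih 0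
      | succ n ihn =>
        obtain ⟨a, ha⟩ := ihn
        obtain ⟨b, hb⟩ := ih (n + 1)
        rw [Set.accumulate_succ]
        exact ⟨_, ha.union hb (hm _) (Set.disjoint_accumulate hd n.lt_succ_self)⟩
    choose a ha using key
    have := Represents.iUnion ha Set.monotone_accumulate
    rw [Set.iUnion_accumulate] at this
    exact ⟨_, this⟩

lemma exists_measure {F : ℝ → M} (hF : Monotone F) {r s : ℝ} (hr : ∀ t ≤ r, F t = 0)
    (hs : ∀ t, s < t → F t = ⊤) (hl : ∀ t, F t ≤ ⨆ u : Set.Iio t, F u) :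
    ∃ μ : states M → Measure ℝ, (∀ ω, IsProbabilityMeasure (μ ω)) ∧
      ∀ t, Represents μ (Set.Iio t) (F t) := by
  have hG : ∀ ω : states M, Monotone fun t => ω.1 (F t) := fun ω s t h => state_mono ω (hF h)
  have hbot : ∀ ω, Tendsto (hG ω).stieltjesFunction atBot (𝓝 0) := fun ω =>
    tendsto_const_nhds.congr' (by
      filter_upwards [eventually_lt_atBot r] with t ht
      refine le_antisymm ?_ ?_
      · refine le_trans ?_ ((hG ω).le_rightLim le_rfl)
        exact state_nonneg _ _
      · refine ((hG ω).rightLim_le ht).trans_eq ?_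
        simp only [hr r le_rfl, state_zero])
  have htop : ∀ ω, Tendsto (hG ω).stieltjesFunction atTop (𝓝 1) := fun ω =>
    tendsto_const_nhds.congr' (by
      filter_upwards [eventually_gt_atTop s] with t ht
      refine le_antisymm ?_ ?_
      · refine le_trans (Eq.le ?_) ((hG ω).le_rightLim le_rfl)
        simp only [hs t ht, state_top]
      · refine ((hG ω).rightLim_le (lt_add_one t)).trans ?_
        exact state_le_one _ _)
  refine ⟨fun ω => (hG ω).stieltjesFunction.measure,
    fun ω => StieltjesFunction.isProbabilityMeasure _ (hbot ω) (htop ω), fun t => ?_⟩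
  let u : ℕ → ℝ := fun n => t - 1 / (n + 1)
  have hu : Monotone u := fun m n hmn => sub_le_sub_left (Nat.one_div_le_one_div hmn) t
  have hut : ∀ n, u n < t := fun n => sub_lt_self _ Nat.one_div_pos_of_nat
  have hFt : F t = ⨆ n, F (u n) := by
    refine le_antisymm ((hl t).trans (iSup_le fun v => ?_)) (iSup_le fun n => hF (hut n).le)
    obtain ⟨n, hn⟩ := exists_nat_one_div_lt (sub_pos.2 (show v.1 < t from v.2))
    exact (hF (by linarith : v.1 ≤ u n)).trans (le_iSup (fun n => F (u n)) n)
  filter_upwards [tendsto_iSup (hF.comp hu)] with ω hω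
  have hlim : Function.leftLim (fun t => ω.1 (F t)) t = ω.1 (F t) := by
    refine le_antisymm ((hG ω).leftLim_le le_rfl) ?_
    have : F t = ⨆ n, (F ∘ u) n := hFt
    rw [this]
    exact le_of_tendsto' hω fun n => (hG ω).le_leftLim (hut n)
  have hst : Function.leftLim (hG ω).stieltjesFunction t = ω.1 (F t) :=
    (leftLim_rightLim ((hG ω).tendsto_leftLim t)).trans hlim
  rw [Measure.real, StieltjesFunction.measure_Iio _ (hbot ω), hst, sub_zero,
    ENNReal.toReal_ofReal (state_nonneg _ _)]

/-- A bounded left continuous resolution extends to an MV-algebra-valued measure. -/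
theorem exists_observable {F : ℝ → M} (hF : Monotone F) {r s : ℝ} (hr : ∀ t ≤ r, F t = 0)
    (hs : ∀ t, s < t → F t = ⊤) (hl : ∀ t, F t ≤ ⨆ u : Set.Iio t, F u) :
    ∃ X : BorelSet → M, X ⟨Set.univ, MeasurableSet.univ⟩ = ⊤ ∧
      (∀ A B : BorelSet, Disjoint A.1 B.1 →
        X A ≤ ⊤ - X B ∧ X ⟨A.1 ∪ B.1, A.2.union B.2⟩ = X A + X B) ∧
      (∀ f : ℕ → BorelSet, (∀ n, (f n).1 ⊆ (f (n + 1)).1) →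
        X ⟨⋃ n, (f n).1, MeasurableSet.iUnion fun n => (f n).2⟩ = ⨆ n, X (f n)) ∧
      ∀ t, X (bIio t) = F t := by
  obtain ⟨μ, _, hμ⟩ := exists_measure hF hr hs hl
  choose X hX using fun A : BorelSet => exists_represents hμ A.2
  refine ⟨X, (hX _).unique represents_univ, fun A B h => ⟨?_, ?_⟩, fun f hf => ?_,
    fun t => (hX _).unique (hμ t)⟩
  · exact (hX A).mono ((hX B).compl B.2) h.subset_compl_right
  · exact (hX _).unique ((hX A).union (hX B) B.2 h)
  · exact (hX _).unique (Represents.iUnion (fun n => hX (f n)) (monotone_nat_of_le_succ hf))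

end Measure

end CompleteMV

namespace EffectAlgebra

/-- A lattice order is the induced order of the effect algebra. -/
def Ordered {E : Type*} [LE E] (EA : EffectAlgebra E) : Prop := ∀ a b, EA.le a b ↔ a ≤ b

/-- Compatibility: `a = a₁ + c` and `b = b₁ + c` with `a₁ + b₁ + c` defined. -/
def Compat {E : Type*} (EA : EffectAlgebra E) (a b : E) : Prop :=
  ∃ a₁ b₁ c d, EA.add a₁ c = some a ∧ EA.add b₁ c = some b ∧ EA.add a₁ b = some d

section Compat

variable {E : Type*} {EA : EffectAlgebra E} {a b c d w x y z : E}

lemma add_left_comm' (h : EA.add b c = some d) (h' : EA.add a d = some x) :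
    ∃ f, EA.add a c = some f ∧ EA.add b f = some x := by
  obtain ⟨f, hf, hf'⟩ := EA.assoc_left (EA.add_symm h) h'
  exact ⟨f, hf, EA.add_symm hf'⟩

lemma Compat.symm (h : EA.Compat a b) : EA.Compat b a := by
  obtain ⟨a₁, b₁, c, d, ha, hb, hd⟩ := h
  obtain ⟨f, hf, hf'⟩ := add_left_comm' hb hd
  rw [ha] at hf
  obtain rfl := Option.some_injective _ hf
  exact ⟨b₁, a₁, c, d, hb, ha, hf'⟩

lemma compat_of_le (h : EA.le a b) : EA.Compat a b := by
  obtain ⟨e, he⟩ := h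
  exact ⟨EA.zero, e, a, b, EA.zero_add a, EA.add_symm he, EA.zero_add b⟩

lemma Compat.orthosupp (h : EA.Compat a b) : EA.Compat a (EA.orthosupp b) := by
  obtain ⟨a₁, b₁, c, d, ha, hb, hd⟩ := h
  obtain ⟨r, hr⟩ := EA.le_one d
  obtain ⟨f, hf, hf'⟩ := EA.assoc_right (EA.add_symm hd) hr
  obtain rfl := EA.eq_orthosupp hf'
  obtain ⟨e, he, -⟩ := EA.add_le_add (EA.add_symm (EA.add_orthosupp b)) (EA.le_of_add' hb)
  exact ⟨c, r, a₁, e, EA.add_symm ha, EA.add_symm hf, EA.add_symm he⟩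

end Compat

section Lattice

variable {E : Type*} {EA : EffectAlgebra E} [CompleteLattice E] {a b c d w x y z : E}

namespace Ordered

lemma eq_bot (h : EA.Ordered) : EA.zero = ⊥ := le_bot_iff.1 ((h _ _).1 (EA.zero_le _))

lemma eq_top (h : EA.Ordered) : EA.one = ⊤ := top_le_iff.1 ((h _ _).1 (EA.le_one _))

lemma le_of_add (h : EA.Ordered) (hab : EA.add a b = some c) : a ≤ c := (h _ _).1 ⟨_, hab⟩

lemma le_of_add' (h : EA.Ordered) (hab : EA.add a b = some c) : b ≤ c :=
  h.le_of_add (EA.add_symm hab)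

lemma exists_add (h : EA.Ordered) (hab : a ≤ b) : ∃ c, EA.add a c = some b := (h _ _).2 hab

lemma add_le_add (h : EA.Ordered) (hac : EA.add a c = some d) (hb : b ≤ c) :
    ∃ e, EA.add a b = some e ∧ e ≤ d := by
  obtain ⟨e, he, he'⟩ := EA.add_le_add hac ((h _ _).2 hb)
  exact ⟨e, he, (h _ _).1 he'⟩

lemma le_of_add_le_add (h : EA.Ordered) (hab : EA.add a b = some d) (hac : EA.add a c = some x)
    (hd : d ≤ x) : b ≤ c :=
  (h _ _).1 (EA.le_of_add_le_add hab hac ((h _ _).2 hd))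

lemma exists_add_iff (h : EA.Ordered) : (∃ c, EA.add a b = some c) ↔ a ≤ EA.orthosupp b :=
  EA.exists_add_iff.trans (h _ _)

lemma orthosupp_le_orthosupp (h : EA.Ordered) (hab : a ≤ b) : EA.orthosupp b ≤ EA.orthosupp a :=
  (h _ _).1 (EA.orthosupp_le_orthosupp ((h _ _).2 hab))

lemma orthosupp_sSup_orthosupp (h : EA.Ordered) (s : Set E) :
    EA.orthosupp (sSup (EA.orthosupp '' s)) = sInf s := by
  refine le_antisymm (le_sInf fun x hx => ?_) ?_
  · have := h.orthosupp_le_orthosupp (le_sSup (Set.mem_image_of_mem EA.orthosupp hx))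
    rwa [EA.orthosupp_orthosupp] at this
  · rw [← EA.orthosupp_orthosupp (sInf s)]
    refine h.orthosupp_le_orthosupp (sSup_le ?_)
    rintro _ ⟨x, hx, rfl⟩
    exact h.orthosupp_le_orthosupp (sInf_le hx)

end Ordered

lemma Compat.exists_sup (hc : EA.Compat a b) (h : EA.Ordered) :
    ∃ a₁ b₁, EA.add (a ⊓ b) a₁ = some a ∧ EA.add (a ⊓ b) b₁ = some b ∧
      EA.add b a₁ = some (a ⊔ b) ∧ EA.add a b₁ = some (a ⊔ b) := by
  obtain ⟨a₁, b₁, c, d, ha, hb, hd⟩ := hc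
  obtain ⟨u, hu⟩ := h.exists_add (le_inf (h.le_of_add' ha) (h.le_of_add' hb))
  obtain ⟨a₂, ha₂⟩ := h.exists_add (inf_le_left : a ⊓ b ≤ a)
  obtain ⟨b₂, hb₂⟩ := h.exists_add (inf_le_right : a ⊓ b ≤ b)
  obtain ⟨f, hf, hf'⟩ := EA.assoc_right hu ha₂
  obtain rfl := EA.add_left_cancel hf' (EA.add_symm ha)
  obtain ⟨d', hd', -⟩ := h.add_le_add (EA.add_symm hd) (h.le_of_add' hf)
  obtain ⟨g, hg, hg'⟩ := EA.assoc_right (EA.add_symm hb₂) hd'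
  rw [ha₂] at hg
  obtain rfl := Option.some_injective _ hg
  obtain ⟨y, hy⟩ := h.exists_add (sup_le (h.le_of_add' hg') (h.le_of_add hd'))
  obtain ⟨u', hu'⟩ := h.exists_add (le_sup_left : a ≤ a ⊔ b)
  obtain ⟨v', hv'⟩ := h.exists_add (le_sup_right : b ≤ a ⊔ b)
  obtain ⟨p, hp, hp'⟩ := EA.assoc_right hu' hy
  obtain rfl := EA.add_left_cancel hp' (EA.add_symm hg')
  obtain ⟨q, hq, hq'⟩ := EA.assoc_right hv' hy
  obtain rfl := EA.add_left_cancel hq' hd'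
  obtain ⟨e, he, hea⟩ := h.add_le_add ha₂ (h.le_of_add' hq)
  obtain ⟨e', he', heb⟩ := h.add_le_add hb₂ (h.le_of_add' hp)
  rw [he] at he'
  obtain rfl := Option.some_injective _ he'
  have hy0 := h.le_of_add_le_add he (EA.add_zero _) (le_inf hea heb)
  rw [h.eq_bot] at hy0
  obtain rfl := le_bot_iff.1 hy0
  rw [← h.eq_bot, EA.add_zero] at hy
  rw [Option.some_injective _ hy]
  exact ⟨_, _, ha₂, hb₂, hd', EA.add_symm hg'⟩

lemma compat_of_add_eq_sup (h : EA.Ordered) (he : EA.add a x = some (a ⊔ b)) (hx : x ≤ b) :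
    EA.Compat a b := by
  obtain ⟨c, hc⟩ := h.exists_add hx
  obtain ⟨f, hf⟩ := h.exists_add (le_sup_right : b ≤ a ⊔ b)
  obtain ⟨g, hg, hg'⟩ := EA.assoc_right hc hf
  obtain rfl := EA.add_left_cancel hg' (EA.add_symm he)
  exact ⟨f, x, c, _, EA.add_symm hg, hc, EA.add_symm hf⟩

lemma Compat.sSup {s : Set E} (h : EA.Ordered) (hs : ∀ y ∈ s, EA.Compat a y) :
    EA.Compat a (sSup s) := by
  have key : ∀ y : s, ∃ x, EA.add a x = some (a ⊔ y) ∧ x ≤ y := by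
    intro y
    obtain ⟨_, b₁, -, hb₁, -, he⟩ := (hs y y.2).exists_sup h
    exact ⟨b₁, he, h.le_of_add' hb₁⟩
  choose e he hey using key
  obtain ⟨x, hx⟩ := h.exists_add (le_sup_left : a ≤ a ⊔ SupSet.sSup s)
  have hex : ⨆ y, e y ≤ x := iSup_le fun y =>
    h.le_of_add_le_add (he y) hx (sup_le_sup_left (le_sSup y.2) a)
  obtain ⟨m, hm, hmle⟩ := h.add_le_add hx hex
  have hms : m = a ⊔ SupSet.sSup s := by
    refine hmle.antisymm (sup_le (h.le_of_add hm) (sSup_le fun y hy => ?_))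
    obtain ⟨p, hp, hpm⟩ := h.add_le_add hm (le_iSup e ⟨y, hy⟩)
    rw [he ⟨y, hy⟩] at hp
    exact le_sup_right.trans ((Option.some_injective _ hp).le.trans hpm)
  rw [hms] at hm
  exact compat_of_add_eq_sup h hm (iSup_le fun y => (hey y).trans (le_sSup y.2))

lemma Compat.sInf {s : Set E} (h : EA.Ordered) (hs : ∀ y ∈ s, EA.Compat a y) :
    EA.Compat a (sInf s) := by
  rw [← h.orthosupp_sSup_orthosupp]
  refine Compat.orthosupp (Compat.sSup h ?_)
  rintro _ ⟨y, hy, rfl⟩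
  exact (hs y hy).orthosupp

lemma Compat.inf (h : EA.Ordered) (hb : EA.Compat a b) (hc : EA.Compat a c) :
    EA.Compat a (b ⊓ c) := by
  rw [← sInf_pair]
  refine Compat.sInf h ?_
  rintro y (rfl | rfl)
  · exact hb
  · exact hc

lemma Compat.of_add (h : EA.Ordered) (hy : EA.Compat a y) (hz : EA.Compat a z)
    (hw : EA.add z w = some y) : EA.Compat a w := by
  obtain ⟨a₁, -, ha, -, hd, -⟩ := hy.exists_sup h
  have hbz : EA.Compat (a ⊓ y) z :=
    (Compat.inf h hz.symm (compat_of_le ((h _ _).2 (h.le_of_add hw)))).symm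
  obtain ⟨b₁, -, hb, -, hbz', -⟩ := hbz.exists_sup h
  obtain ⟨f, hf⟩ := h.exists_add (sup_le inf_le_right (h.le_of_add hw) : a ⊓ y ⊔ z ≤ y)
  obtain ⟨g, hg, hg'⟩ := EA.assoc_right hbz' hf
  obtain rfl := EA.add_left_cancel hg' hw
  obtain ⟨p, hp, hp'⟩ := EA.assoc_right (EA.add_symm hb) ha
  obtain ⟨q, hq, hqy⟩ := h.add_le_add (EA.add_symm hw) (inf_le_right : a ⊓ y ⊓ z ≤ z)
  obtain ⟨r, hr, -⟩ := h.add_le_add (EA.add_symm hd) hqy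
  obtain ⟨t, ht, ht'⟩ := add_left_comm' hq hr
  rw [EA.comm, hp] at ht
  obtain rfl := Option.some_injective _ ht
  exact ⟨p, f, b₁, r, EA.add_symm hp', EA.add_symm hg, EA.add_symm ht'⟩

end Lattice

end EffectAlgebra

namespace EffectAlgebra

section Block

variable {E : Type*} {EA : EffectAlgebra E} [CompleteLattice E] {a b c d w x y z : E}

namespace Ordered

lemma inf_le_right_orthosupp (h : EA.Ordered) (a b : E) :
    ∃ c, EA.add a (b ⊓ EA.orthosupp a) = some c := by
  obtain ⟨c, hc⟩ := h.exists_add_iff.2 (inf_le_right : b ⊓ EA.orthosupp a ≤ _)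
  exact ⟨c, EA.add_symm hc⟩

/-- The total difference `a - a ⊓ b`. -/
noncomputable def sub (h : EA.Ordered) (a b : E) : E :=
  Classical.choose (h.exists_add (inf_le_left : a ⊓ b ≤ a))

/-- The total sum `a + b ⊓ a'`. -/
noncomputable def add (h : EA.Ordered) (a b : E) : E :=
  Classical.choose (h.inf_le_right_orthosupp a b)

lemma inf_add_sub (h : EA.Ordered) (a b : E) : EA.add (a ⊓ b) (h.sub a b) = some a :=
  Classical.choose_spec (h.exists_add inf_le_left)

lemma add_inf_orthosupp (h : EA.Ordered) (a b : E) :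
    EA.add a (b ⊓ EA.orthosupp a) = some (h.add a b) :=
  Classical.choose_spec (h.inf_le_right_orthosupp a b)

lemma add_eq_of_add (h : EA.Ordered) (hc : EA.add a b = some c) : h.add a b = c := by
  have := h.add_inf_orthosupp a b
  rw [inf_eq_left.2 (h.exists_add_iff.1 ⟨c, EA.add_symm hc⟩), hc] at this
  exact (Option.some_injective _ this).symm

lemma sub_eq_of_add (h : EA.Ordered) (hc : EA.add b c = some a) : h.sub a b = c := by
  have := h.inf_add_sub a b
  rw [inf_eq_right.2 (h.le_of_add hc)] at this
  exact EA.add_left_cancel this hc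

lemma orthosupp_sup (h : EA.Ordered) (a b : E) :
    EA.orthosupp (a ⊔ b) = EA.orthosupp a ⊓ EA.orthosupp b := by
  refine le_antisymm (le_inf (h.orthosupp_le_orthosupp le_sup_left)
    (h.orthosupp_le_orthosupp le_sup_right)) ?_
  rw [← EA.orthosupp_orthosupp (EA.orthosupp a ⊓ EA.orthosupp b)]
  refine h.orthosupp_le_orthosupp (sup_le ?_ ?_)
  · simpa only [EA.orthosupp_orthosupp] using
      h.orthosupp_le_orthosupp (inf_le_left : EA.orthosupp a ⊓ EA.orthosupp b ≤ _)
  · simpa only [EA.orthosupp_orthosupp] using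
      h.orthosupp_le_orthosupp (inf_le_right : EA.orthosupp a ⊓ EA.orthosupp b ≤ _)

lemma add_sub_eq_sup (h : EA.Ordered) (hc : EA.Compat a b) :
    EA.add b (h.sub a b) = some (a ⊔ b) := by
  obtain ⟨a₁, -, h1, -, h2, -⟩ := hc.exists_sup h
  rwa [EA.add_left_cancel (h.inf_add_sub a b) h1]

lemma add_comm (h : EA.Ordered) (hc : EA.Compat a b) : h.add a b = h.add b a := by
  obtain ⟨b₁, p, hb, -, hd, -⟩ := hc.symm.orthosupp.exists_sup h
  obtain ⟨f, hf, hf'⟩ := EA.assoc_right hd (EA.add_orthosupp _)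
  obtain rfl : a = f := by rw [EA.eq_orthosupp hf', EA.orthosupp_orthosupp]
  have hr : EA.orthosupp (b ⊔ EA.orthosupp a) = a ⊓ EA.orthosupp b := by
    rw [h.orthosupp_sup, EA.orthosupp_orthosupp, inf_comm]
  rw [hr] at hf
  obtain ⟨g, hg, hg'⟩ := EA.assoc_right hb (h.add_inf_orthosupp b a)
  rw [hf] at hg
  obtain rfl := Option.some_injective _ hg
  have := EA.add_symm (h.add_inf_orthosupp a b)
  rw [hg'] at this
  exact (Option.some_injective _ this).symm

lemma sub_le_iff (h : EA.Ordered) (hc : EA.Compat a b) : h.sub a b ≤ c ↔ a ≤ h.add b c := by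
  have hs := h.add_sub_eq_sup hc
  have ha := h.add_inf_orthosupp b c
  constructor
  · intro hle
    obtain ⟨e, he, hle'⟩ := h.add_le_add ha
      (le_inf hle (h.exists_add_iff.1 ⟨_, EA.add_symm hs⟩))
    rw [hs] at he
    obtain rfl := Option.some_injective _ he
    exact le_sup_left.trans hle'
  · intro hle
    exact (h.le_of_add_le_add hs ha (sup_le hle (h.le_of_add ha))).trans inf_le_left

end Ordered

/-- A complete sublattice of pairwise compatible elements that is closed under orthosupplements
and differences. -/
structure IsBlock (EA : EffectAlgebra E) (L : CompleteSublattice E) : Prop where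
  compat : ∀ a ∈ L, ∀ b ∈ L, EA.Compat a b
  orthosupp_mem : ∀ a ∈ L, EA.orthosupp a ∈ L
  mem_of_add : ∀ a ∈ L, ∀ b, ∀ c ∈ L, EA.add a b = some c → b ∈ L

lemma exists_isBlock (h : EA.Ordered) {s : Set E} (hs : ∀ a ∈ s, ∀ b ∈ s, EA.Compat a b) :
    ∃ L : CompleteSublattice E, EA.IsBlock L ∧ s ⊆ L := by
  let C : Set E → Set E := fun t => {a | ∀ b ∈ t, EA.Compat b a}
  have hsC : s ⊆ C s := fun a ha b hb => hs b hb a ha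
  have hCC : C (C s) ⊆ C s := fun a ha b hb => ha b (hsC hb)
  refine ⟨CompleteSublattice.mk' (C (C s))
    (fun t ht b hb => Compat.sSup h fun y hy => ht hy b hb)
    (fun t ht b hb => Compat.sInf h fun y hy => ht hy b hb), ⟨?_, ?_, ?_⟩, ?_⟩
  · exact fun a ha b hb => hb a (hCC ha)
  · exact fun a ha b hb => (ha b hb).orthosupp
  · exact fun a ha b c hc habc x hx => Compat.of_add h (hc x hx) (ha x hx) habc
  · exact fun a ha b hb => (hb a ha).symm

namespace IsBlock

variable {L : CompleteSublattice E}

lemma add_mem (hL : EA.IsBlock L) (ha : a ∈ L) (hb : b ∈ L) (hc : EA.add a b = some c) :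
    c ∈ L := by
  obtain ⟨f, hf, hf'⟩ := EA.assoc_right (EA.add_symm hc) (EA.add_orthosupp c)
  have h1 : EA.orthosupp c ∈ L := hL.mem_of_add a ha _ _ (hL.orthosupp_mem b hb)
    (EA.eq_orthosupp hf' ▸ hf)
  rw [← EA.orthosupp_orthosupp c]
  exact hL.orthosupp_mem _ h1

lemma totalSub_mem (hL : EA.IsBlock L) (h : EA.Ordered) (ha : a ∈ L) (hb : b ∈ L) :
    h.sub a b ∈ L :=
  hL.mem_of_add _ (L.infClosed' ha hb) _ _ ha (h.inf_add_sub a b)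

lemma totalAdd_mem (hL : EA.IsBlock L) (h : EA.Ordered) (ha : a ∈ L) (hb : b ∈ L) :
    h.add a b ∈ L :=
  hL.add_mem ha (L.infClosed' hb (hL.orthosupp_mem a ha)) (h.add_inf_orthosupp a b)

lemma totalSub_le_iff (hL : EA.IsBlock L) (h : EA.Ordered) (ha : a ∈ L) (hb : b ∈ L) (hc : c ∈ L) :
    h.sub a b ≤ c ↔ a ≤ h.add c b := by
  rw [h.sub_le_iff (hL.compat a ha b hb), h.add_comm (hL.compat b hb c hc)]

lemma totalAdd_comm (hL : EA.IsBlock L) (h : EA.Ordered) (ha : a ∈ L) (hb : b ∈ L) :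
    h.add a b = h.add b a := h.add_comm (hL.compat a ha b hb)

lemma totalAdd_le_totalAdd (hL : EA.IsBlock L) (h : EA.Ordered) (ha : a ∈ L) (hb : b ∈ L)
    (hc : c ∈ L) (hab : a ≤ b) : h.add a c ≤ h.add b c := by
  rw [← hL.totalSub_le_iff h (hL.totalAdd_mem h ha hc) hc hb]
  exact ((hL.totalSub_le_iff h (hL.totalAdd_mem h ha hc) hc ha).2 le_rfl).trans hab

lemma le_totalAdd_of_add (hL : EA.IsBlock L) (h : EA.Ordered) (ha : a ∈ L) (hb : b ∈ L)
    (hx : x ∈ L) (hy : y ∈ L) (hz : EA.add x y = some z) (hxa : x ≤ a) (hyb : y ≤ b) :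
    z ≤ h.add a b := by
  rw [← h.add_eq_of_add hz]
  refine (hL.totalAdd_le_totalAdd h hx ha hy hxa).trans ?_
  rw [hL.totalAdd_comm h ha hy, hL.totalAdd_comm h ha hb]
  exact hL.totalAdd_le_totalAdd h hy hb ha hyb

lemma totalAdd_assoc_le (hL : EA.IsBlock L) (h : EA.Ordered) (ha : a ∈ L) (hb : b ∈ L)
    (hc : c ∈ L) : h.add (h.add a b) c ≤ h.add a (h.add b c) := by
  have hab := hL.totalAdd_mem h ha hb
  rw [hL.totalAdd_comm h hab hc]
  set q := h.add a b ⊓ EA.orthosupp c with hq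
  have hqL : q ∈ L := L.infClosed' hab (hL.orthosupp_mem c hc)
  have hsub : h.sub q a ≤ b := by
    rw [h.sub_le_iff (hL.compat q hqL a ha)]
    exact inf_le_left
  obtain ⟨f, hf, hf'⟩ := add_left_comm' (h.inf_add_sub q a) (h.add_inf_orthosupp c (h.add a b))
  have hs := hL.totalSub_mem h hqL ha
  have hfL := hL.add_mem hc hs hf
  refine hL.le_totalAdd_of_add h ha (hL.totalAdd_mem h hb hc) (L.infClosed' hqL ha) hfL hf'
    inf_le_right ?_
  exact hL.le_totalAdd_of_add h hb hc hs hc (EA.add_symm hf) hsub le_rfl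

lemma totalAdd_assoc (hL : EA.IsBlock L) (h : EA.Ordered) (ha : a ∈ L) (hb : b ∈ L)
    (hc : c ∈ L) : h.add (h.add a b) c = h.add a (h.add b c) := by
  refine (hL.totalAdd_assoc_le h ha hb hc).antisymm ?_
  rw [hL.totalAdd_comm h ha (hL.totalAdd_mem h hb hc), hL.totalAdd_comm h hb hc,
    hL.totalAdd_comm h (hL.totalAdd_mem h ha hb) hc, hL.totalAdd_comm h ha hb]
  exact hL.totalAdd_assoc_le h hc hb ha

/-- The truncated addition of a block. -/
noncomputable abbrev addCommMonoid (hL : EA.IsBlock L) (h : EA.Ordered) : AddCommMonoid L :=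
  letI : Zero L := ⟨⊥⟩
  letI : Add L := ⟨fun a b => ⟨h.add a b, hL.totalAdd_mem h a.2 b.2⟩⟩
  { nsmul := nsmulRec
    add_assoc := fun a b c => Subtype.ext (hL.totalAdd_assoc h a.2 b.2 c.2)
    add_comm := fun a b => Subtype.ext (hL.totalAdd_comm h a.2 b.2)
    zero_add := fun a => Subtype.ext (h.add_eq_of_add
      (show EA.add ⊥ a.1 = some a.1 from h.eq_bot ▸ EA.zero_add a.1))
    add_zero := fun a => Subtype.ext (h.add_eq_of_add
      (show EA.add a.1 ⊥ = some a.1 from h.eq_bot ▸ EA.add_zero a.1)) }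

/-- A block of a complete lattice effect algebra is a complete MV-algebra. -/
noncomputable abbrev completeMV (hL : EA.IsBlock L) (h : EA.Ordered) : CompleteMV L :=
  { (inferInstance : CompleteLattice L), hL.addCommMonoid h with
    sub := fun a b => ⟨h.sub a b, hL.totalSub_mem h a.2 b.2⟩
    add_le_add_left' := fun a b hab c => hL.totalAdd_le_totalAdd h a.2 b.2 c.2 hab
    le_add := fun a b => h.le_of_add (h.add_inf_orthosupp a.1 b.1)
    sub_le_iff := fun a b c => hL.totalSub_le_iff h a.2 b.2 c.2
    sub_add_cancel_of_le := fun a b hba => Subtype.ext (by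
      have := h.inf_add_sub a.1 b.1
      rw [inf_eq_right.2 (show b.1 ≤ a.1 from hba)] at this
      exact h.add_eq_of_add (EA.add_symm this))
    sub_sub_eq_inf := fun a b => Subtype.ext
      (h.sub_eq_of_add (EA.add_symm (h.inf_add_sub a.1 b.1))) }

end IsBlock

/-- A bounded left continuous resolution in a complete lattice effect algebra is the
distribution of an observable. -/
theorem Ordered.exists_observable (h : EA.Ordered) {F : ℝ → E} (hF : Monotone F) {r s : ℝ}
    (hr : ∀ t ≤ r, F t = ⊥) (hs : ∀ t, s < t → F t = ⊤) (hl : ∀ t, F t ≤ ⨆ u : Set.Iio t, F u) :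
    ∃ x : Observable EA, ∀ t, x.toFun (bIio t) = F t := by
  obtain ⟨L, hL, hFL⟩ := exists_isBlock h (s := Set.range F) (by
    rintro _ ⟨t, rfl⟩ _ ⟨u, rfl⟩
    rcases le_total t u with htu | htu
    · exact compat_of_le ((h _ _).2 (hF htu))
    · exact (compat_of_le ((h _ _).2 (hF htu))).symm)
  let := hL.completeMV h
  let G : ℝ → L := fun t => ⟨F t, hFL ⟨t, rfl⟩⟩
  obtain ⟨X, h1, hadd, hsup, hX⟩ := CompleteMV.exists_observable (F := G) (fun t u htu => hF htu)
    (fun t ht => Subtype.ext (hr t ht)) (fun t ht => Subtype.ext (hs t ht)) (fun t => by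
      change (G t : E) ≤ ((⨆ u : Set.Iio t, G u : L) : E)
      rw [CompleteSublattice.coe_iSup]
      exact hl t)
  refine ⟨⟨fun A => X A, ?_, fun A B hAB => ?_, fun f hf => ?_⟩, fun t => ?_⟩
  · rw [h1, h.eq_top]
    rfl
  · obtain ⟨hle, heq⟩ := hadd A B hAB
    have hle' : (X A : E) ≤ EA.orthosupp (X B) := by
      have : h.sub ⊤ (X B : E) = EA.orthosupp (X B) :=
        h.sub_eq_of_add (h.eq_top ▸ EA.add_orthosupp _)
      exact this ▸ hle
    obtain ⟨c, hc⟩ := h.exists_add_iff.2 hle'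
    rw [heq, hc]
    exact congrArg some (h.add_eq_of_add hc).symm
  · rw [hsup f hf]
    change EA.IsSup _ ((⨆ n, X (f n) : L) : E)
    rw [CompleteSublattice.coe_iSup]
    refine ⟨?_, fun b hb => (h _ _).2 (iSup_le fun n => (h _ _).1 (hb _ ⟨n, rfl⟩))⟩
    rintro _ ⟨n, rfl⟩
    exact (h _ _).2 (le_iSup (fun n => (X (f n) : E)) n)
  · exact congrArg Subtype.val (hX t)

end Block

end EffectAlgebra

namespace EffectAlgebra

lemma exists_completeLattice {E : Type*} {EA : EffectAlgebra E} (hE : EA.CompleteEA) :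
    ∃ _ : CompleteLattice E, EA.Ordered := by
  let : PartialOrder E :=
    { le := EA.le
      le_refl := EA.le_refl'
      le_trans := fun _ _ _ => EA.le_trans'
      le_antisymm := fun _ _ => EA.le_antisymm' }
  let : SupSet E := ⟨fun s => Classical.choose (hE.1 s)⟩
  refine ⟨completeLatticeOfSup E fun s => ?_, fun _ _ => Iff.rfl⟩
  obtain ⟨h1, h2⟩ := Classical.choose_spec (hE.1 s)
  exact ⟨fun x hx => h1 x hx, fun b hb => h2 b fun x hx => hb hx⟩

end EffectAlgebra

namespace Observable

/-- The spectrum of `x` lies in `[r, s]`. -/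
def SupportedIn {E : Type*} {EA : EffectAlgebra E} (x : Observable EA) (r s : ℝ) : Prop :=
  x.toFun ⟨Set.Icc r s, measurableSet_Icc⟩ = EA.one

variable {E : Type*} {EA : EffectAlgebra E}

lemma add_toFun_Ici (x : Observable EA) (t : ℝ) :
    EA.add (x.toFun (bIio t)) (x.toFun ⟨Set.Ici t, measurableSet_Ici⟩) = some EA.one := by
  have := x.additive (bIio t) ⟨Set.Ici t, measurableSet_Ici⟩
    (Set.disjoint_left.2 fun u (hu : u < t) (hu' : t ≤ u) => not_lt_of_ge hu' hu)
  simp only [bIio, Set.Iio_union_Ici, x.unital] at this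
  exact this

variable [CompleteLattice E] {x : Observable EA} {r s t : ℝ}

lemma mono (h : EA.Ordered) (x : Observable EA) {A B : BorelSet} (hAB : A.1 ⊆ B.1) :
    x.toFun A ≤ x.toFun B := by
  have := x.additive A ⟨B.1 \ A.1, B.2.diff A.2⟩ Set.disjoint_sdiff_right
  simp only [Set.union_sdiff_cancel hAB] at this
  exact h.le_of_add this

lemma le_iSup_of_iUnion (h : EA.Ordered) (x : Observable EA) (f : ℕ → BorelSet)
    (hf : ∀ n, (f n).1 ⊆ (f (n + 1)).1) {A : BorelSet} (hA : A.1 = ⋃ n, (f n).1) :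
    x.toFun A ≤ ⨆ n, x.toFun (f n) := by
  obtain ⟨-, h2⟩ := x.sup_cont f hf
  have hA' : A = ⟨⋃ n, (f n).1, MeasurableSet.iUnion fun n => (f n).2⟩ := Subtype.ext hA
  rw [hA']
  refine (h _ _).1 (h2 _ ?_)
  rintro _ ⟨n, rfl⟩
  exact (h _ _).2 (le_iSup (fun n => x.toFun (f n)) n)

lemma toFun_bIio_le_iSup (h : EA.Ordered) (x : Observable EA) (t : ℝ) :
    x.toFun (bIio t) ≤ ⨆ u : Set.Iio t, x.toFun (bIio u) := by
  refine (x.le_iSup_of_iUnion h (fun n => bIio (t - 1 / (n + 1))) (fun n => ?_) ?_).trans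
    (iSup_le fun n => le_iSup (fun u : Set.Iio t => x.toFun (bIio u))
      ⟨_, sub_lt_self t Nat.one_div_pos_of_nat⟩)
  · exact Set.Iio_subset_Iio (sub_le_sub_left (Nat.one_div_le_one_div n.le_succ) t)
  · ext u
    simp only [bIio, Set.mem_iUnion, Set.mem_Iio]
    constructor
    · intro hu
      obtain ⟨n, hn⟩ := exists_nat_one_div_lt (sub_pos.2 hu)
      exact ⟨n, by linarith⟩
    · rintro ⟨n, hn⟩
      exact hn.trans (sub_lt_self t Nat.one_div_pos_of_nat)

lemma toFun_Ioi_eq_bot (h : EA.Ordered) (hs : ∀ t, s < t → x.toFun (bIio t) = ⊤) :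
    x.toFun ⟨Set.Ioi s, measurableSet_Ioi⟩ = ⊥ := by
  refine le_bot_iff.1 ((x.le_iSup_of_iUnion h
    (fun n => ⟨Set.Ici (s + 1 / (n + 1)), measurableSet_Ici⟩) (fun n => ?_) ?_).trans
    (iSup_le fun n => ?_))
  · exact Set.Ici_subset_Ici.2 (add_le_add_right (Nat.one_div_le_one_div n.le_succ) s)
  · ext u
    simp only [Set.mem_iUnion, Set.mem_Ioi, Set.mem_Ici]
    constructor
    · intro hu
      obtain ⟨n, hn⟩ := exists_nat_one_div_lt (sub_pos.2 hu)
      exact ⟨n, by linarith⟩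
    · rintro ⟨n, hn⟩
      exact (lt_add_of_pos_right s Nat.one_div_pos_of_nat).trans_le hn
  · have := x.add_toFun_Ici (s + 1 / (n + 1))
    rw [hs _ (lt_add_of_pos_right s Nat.one_div_pos_of_nat), ← h.eq_top] at this
    rw [EA.pos_one _ _ (EA.add_symm this), h.eq_bot]

lemma supportedIn_iff (h : EA.Ordered) : x.SupportedIn r s ↔
    (∀ t ≤ r, x.toFun (bIio t) = ⊥) ∧ ∀ t, s < t → x.toFun (bIio t) = ⊤ := by
  constructor
  · intro hx
    refine ⟨fun t ht => ?_, fun t ht => ?_⟩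
    · have := x.additive (bIio t) ⟨Set.Icc r s, measurableSet_Icc⟩
        (Set.disjoint_left.2 fun u hu hu' => not_lt_of_ge (ht.trans hu'.1) hu)
      rw [hx] at this
      rw [EA.pos_one _ _ this, h.eq_bot]
    · refine top_le_iff.1 (h.eq_top ▸ hx ▸ x.mono h fun u hu => ?_)
      exact hu.2.trans_lt ht
  · rintro ⟨hr, hs⟩
    rw [SupportedIn, h.eq_top]
    rcases le_or_gt r s with hrs | hrs
    · have h1 := x.add_toFun_Ici r
      rw [hr r le_rfl, ← h.eq_bot, EA.zero_add] at h1
      have h2 := x.additive ⟨Set.Icc r s, measurableSet_Icc⟩ ⟨Set.Ioi s, measurableSet_Ioi⟩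
        (Set.disjoint_left.2 fun u hu hu' => not_lt_of_ge hu.2 hu')
      simp only [Set.Icc_union_Ioi_eq_Ici hrs] at h2
      rw [toFun_Ioi_eq_bot h hs, ← h.eq_bot, EA.add_zero, h1] at h2
      rw [Option.some_injective _ h2, h.eq_top]
    · have : (⊤ : E) = ⊥ := (hs r hrs).symm.trans (hr r le_rfl)
      exact top_le_iff.1 (this.le.trans bot_le)

lemma bounded_iff (h : EA.Ordered) : x.Bounded ↔ ∃ r s, x.SupportedIn r s := by
  constructor
  · rintro ⟨C, hC, hx⟩
    obtain ⟨r, hr⟩ := hC.bddBelow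
    obtain ⟨s, hs⟩ := hC.bddAbove
    refine ⟨r, s, ?_⟩
    rw [SupportedIn, h.eq_top]
    exact top_le_iff.1 (h.eq_top ▸ hx ▸ x.mono h fun u hu => ⟨hr hu, hs hu⟩)
  · rintro ⟨r, s, hx⟩
    exact ⟨_, isCompact_Icc, hx⟩

lemma exists_inf (h : EA.Ordered) {S : Set (Observable EA)}
    (hr : ∀ x ∈ S, ∀ t ≤ r, x.toFun (bIio t) = ⊥)
    (hs : ∃ x ∈ S, ∀ t, s < t → x.toFun (bIio t) = ⊤) :
    ∃ z : Observable EA, z.SupportedIn r s ∧ (∀ x ∈ S, z.OlsonLe x) ∧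
      ∀ w : Observable EA, (∀ x ∈ S, w.OlsonLe x) → w.OlsonLe z := by
  obtain ⟨x₀, hx₀, hs⟩ := hs
  have hr' : ∀ t ≤ r, ⨆ x : S, x.1.toFun (bIio t) = ⊥ := fun t ht =>
    le_bot_iff.1 (iSup_le fun x => (hr x x.2 t ht).le)
  have hs' : ∀ t, s < t → ⨆ x : S, x.1.toFun (bIio t) = ⊤ := fun t ht =>
    top_le_iff.1 ((hs t ht).ge.trans (le_iSup (fun x : S => x.1.toFun (bIio t)) ⟨x₀, hx₀⟩))
  obtain ⟨z, hz⟩ := h.exists_observable (F := fun t => ⨆ x : S, x.1.toFun (bIio t))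
    (fun t u htu => iSup_mono fun x => x.1.mono h (Set.Iio_subset_Iio htu)) hr' hs'
    (fun t => iSup_le fun x => (x.1.toFun_bIio_le_iSup h t).trans
      (iSup_mono fun u => le_iSup (fun x : S => x.1.toFun (bIio u)) x))
  refine ⟨z, (supportedIn_iff h).2 ?_, fun x hx t => ?_, fun w hw t => ?_⟩
  · simp only [hz]
    exact ⟨hr', hs'⟩
  · rw [h, hz]
    exact le_iSup (fun x : S => x.1.toFun (bIio t)) ⟨x, hx⟩
  · rw [h, hz]
    exact iSup_le fun x => (h _ _).1 (hw x x.2 t)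

lemma exists_sup (h : EA.Ordered) {S : Set (Observable EA)}
    (hr : ∃ x ∈ S, ∀ t ≤ r, x.toFun (bIio t) = ⊥)
    (hs : ∀ x ∈ S, ∀ t, s < t → x.toFun (bIio t) = ⊤) :
    ∃ z : Observable EA, z.SupportedIn r s ∧ (∀ x ∈ S, x.OlsonLe z) ∧
      ∀ w : Observable EA, (∀ x ∈ S, x.OlsonLe w) → z.OlsonLe w := by
  obtain ⟨x₀, hx₀, hr⟩ := hr
  let G : ℝ → E := fun u => ⨅ x : S, x.1.toFun (bIio u)
  have hG : ∀ {u t : ℝ} {x : Observable EA}, x ∈ S → u ≤ t → G u ≤ x.toFun (bIio t) :=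
    fun {u t x} hx hut => (iInf_le (fun x : S => x.1.toFun (bIio u)) ⟨x, hx⟩).trans
      (x.mono h (Set.Iio_subset_Iio hut))
  have hGF : ∀ {u t : ℝ}, u < t → G u ≤ ⨆ u : Set.Iio t, G u := fun {u t} hut =>
    le_iSup (fun u : Set.Iio t => G u) ⟨u, hut⟩
  have hr' : ∀ t ≤ r, ⨆ u : Set.Iio t, G u = ⊥ := fun t ht =>
    le_bot_iff.1 (iSup_le fun u => (hG hx₀ (le_of_lt u.2)).trans (hr t ht).le)
  have hs' : ∀ t, s < t → ⨆ u : Set.Iio t, G u = ⊤ := fun t ht => by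
    obtain ⟨u, hsu, hut⟩ := exists_between ht
    exact top_le_iff.1 ((le_iInf fun x : S => (hs x.1 x.2 u hsu).ge).trans (hGF hut))
  obtain ⟨z, hz⟩ := h.exists_observable (F := fun t => ⨆ u : Set.Iio t, G u)
    (fun t u htu => iSup_le fun v => hGF (lt_of_lt_of_le v.2 htu)) hr' hs' (fun t =>
      iSup_le fun u => by
        obtain ⟨v, huv, hvt⟩ := exists_between (show u.1 < t from u.2)
        exact (hGF huv).trans (le_iSup (fun v : Set.Iio t => ⨆ u : Set.Iio v.1, G u) ⟨v, hvt⟩))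
  refine ⟨z, (supportedIn_iff h).2 ?_, fun x hx t => ?_, fun w hw t => ?_⟩
  · simp only [hz]
    exact ⟨hr', hs'⟩
  · rw [h, hz]
    exact iSup_le fun u => hG hx (le_of_lt u.2)
  · rw [h, hz]
    refine (w.toFun_bIio_le_iSup h t).trans (iSup_mono fun u => le_iInf fun x => ?_)
    exact (h _ _).1 (hw x x.2 u)

end Observable

/-- the bounded observables of a complete lattice effect algebra
form a Dedekind complete lattice under the Olson order, and the observables with
spectrum in `[0,1]` form a complete lattice with bottom `q_0` and top `q_1`. -/
theorem stmt14 {E : Type*} (EA : EffectAlgebra E) (hE : EA.CompleteEA) :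
    (∀ S : Set (Observable EA), S.Nonempty → (∀ x ∈ S, x.Bounded) →
      (∃ y : Observable EA, y.Bounded ∧ ∀ x ∈ S, y.OlsonLe x) →
      ∃ z : Observable EA, Observable.IsOlsonInf S z) ∧
    (∀ S : Set (Observable EA), S.Nonempty → (∀ x ∈ S, x.Bounded) →
      (∃ y : Observable EA, y.Bounded ∧ ∀ x ∈ S, x.OlsonLe y) →
      ∃ z : Observable EA, Observable.IsOlsonSup S z) ∧
    (∀ S : Set (Observable EA), S.Nonempty → (∀ x ∈ S, x.SpectrumIn01) →
      (∃ z : Observable EA, z.SpectrumIn01 ∧ (∀ x ∈ S, z.OlsonLe x) ∧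
        ∀ w : Observable EA, w.SpectrumIn01 → (∀ x ∈ S, w.OlsonLe x) → w.OlsonLe z) ∧
      (∃ z : Observable EA, z.SpectrumIn01 ∧ (∀ x ∈ S, x.OlsonLe z) ∧
        ∀ w : Observable EA, w.SpectrumIn01 → (∀ x ∈ S, x.OlsonLe w) → z.OlsonLe w)) ∧
    (∀ q0 : Observable EA, q0.IsQuestion EA.zero →
      q0.SpectrumIn01 ∧ ∀ x : Observable EA, x.SpectrumIn01 → q0.OlsonLe x) ∧
    (∀ q1 : Observable EA, q1.IsQuestion EA.one →
      q1.SpectrumIn01 ∧ ∀ x : Observable EA, x.SpectrumIn01 → x.OlsonLe q1) := by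
  obtain ⟨_, h⟩ := EffectAlgebra.exists_completeLattice hE
  refine ⟨?_, ?_, ?_, ?_, ?_⟩
  · rintro S ⟨x, hx⟩ hS ⟨y, hy, hyS⟩
    obtain ⟨r, _, hy⟩ := (Observable.bounded_iff h).1 hy
    obtain ⟨_, s, hxs⟩ := (Observable.bounded_iff h).1 (hS x hx)
    rw [Observable.supportedIn_iff h] at hy hxs
    obtain ⟨z, hz, hle, hz'⟩ := Observable.exists_inf h (S := S) (r := r) (s := s)
      (fun x hx t ht => le_bot_iff.1 (((h _ _).1 (hyS x hx t)).trans (hy.1 t ht).le))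
      ⟨x, hx, hxs.2⟩
    exact ⟨z, (Observable.bounded_iff h).2 ⟨r, s, hz⟩, hle, fun w _ => hz' w⟩
  · rintro S ⟨x, hx⟩ hS ⟨y, hy, hyS⟩
    obtain ⟨_, s, hy⟩ := (Observable.bounded_iff h).1 hy
    obtain ⟨r, _, hxr⟩ := (Observable.bounded_iff h).1 (hS x hx)
    rw [Observable.supportedIn_iff h] at hy hxr
    obtain ⟨z, hz, hle, hz'⟩ := Observable.exists_sup h (S := S) (r := r) (s := s)
      ⟨x, hx, hxr.1⟩
      (fun x hx t ht => top_le_iff.1 ((hy.2 t ht).ge.trans ((h _ _).1 (hyS x hx t))))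
    exact ⟨z, (Observable.bounded_iff h).2 ⟨r, s, hz⟩, hle, fun w _ => hz' w⟩
  · rintro S ⟨x, hx⟩ hS
    have hS' := fun x hx => (Observable.supportedIn_iff h).1 (hS x hx)
    obtain ⟨z, hz, hle, hz'⟩ := Observable.exists_inf h (S := S) (fun x hx => (hS' x hx).1)
      ⟨x, hx, (hS' x hx).2⟩
    obtain ⟨y, hy, hley, hy'⟩ := Observable.exists_sup h (S := S) ⟨x, hx, (hS' x hx).1⟩
      (fun x hx => (hS' x hx).2)
    exact ⟨⟨z, hz, hle, fun w _ => hz' w⟩, ⟨y, hy, hley, fun w _ => hy' w⟩⟩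
  · intro q hq
    have h0 : ∀ t ≤ 0, q.toFun (bIio t) = ⊥ := fun t ht => by rw [hq, if_pos ht, h.eq_bot]
    have h1 : ∀ t, 0 < t → q.toFun (bIio t) = ⊤ := fun t ht => by
      rw [hq, if_neg ht.not_ge, EA.orthosupp_zero, ite_self, h.eq_top]
    refine ⟨(Observable.supportedIn_iff h).2 ⟨h0, fun t ht => h1 t (one_pos.trans ht)⟩,
      fun x hx t => (h _ _).2 ?_⟩
    rcases le_or_gt t 0 with ht | ht
    · rw [((Observable.supportedIn_iff h).1 hx).1 t ht]
      exact bot_le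
    · rw [h1 t ht]
      exact le_top
  · intro q hq
    have h0 : ∀ t ≤ 1, q.toFun (bIio t) = ⊥ := fun t ht => by
      rw [hq, if_pos ht, EA.orthosupp_one, ite_self, h.eq_bot]
    have h1 : ∀ t, 1 < t → q.toFun (bIio t) = ⊤ := fun t ht => by
      rw [hq, if_neg (one_pos.trans ht).not_ge, if_neg ht.not_ge, h.eq_top]
    refine ⟨(Observable.supportedIn_iff h).2 ⟨fun t ht => h0 t (ht.trans zero_le_one), h1⟩,
      fun x hx t => (h _ _).2 ?_⟩
    rcases le_or_gt t 1 with ht | ht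
    · rw [h0 t ht]
      exact bot_le
    · rw [((Observable.supportedIn_iff h).1 hx).2 t ht]
      exact le_top
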